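/- arXiv:1301.1097 — 2 statements merged into one kernel-verified Lean document; each statement's English description precedes it below -/
import Mathlib

section
/- A finite graph G = (V, E) contains k pairwise edge-disjoint spanning trees if and only if for every partition P of V, the number of edges of G joining vertices in different parts of P is at least k(|P| - 1). -/
open scoped Classical
open Filter

/-- Number of edges of a finite simple graph. -/
noncomputable def edgeCount {V : Type*} [Fintype V] (G : SimpleGraph V) : ℕ :=
  G.edgeFinset.card

/-- `G` contains `k` pairwise edge-disjoint spanning trees. -/
def HasDisjSpanningTrees {V : Type*} (G : SimpleGraph V) (k : ℕ) : Prop :=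
  ∃ f : Fin k → SimpleGraph V, (∀ i, f i ≤ G) ∧ (∀ i, (f i).IsTree) ∧
    ∀ i j, i ≠ j → Disjoint (f i).edgeSet (f j).edgeSet

/-- Spanning tree packing number: the maximum number of pairwise
edge-disjoint spanning trees of `G`. -/
noncomputable def stp {V : Type*} (G : SimpleGraph V) : ℕ :=
  sSup {k | HasDisjSpanningTrees G k}

/-- Number of edges of `G` between `S` and its complement. -/
noncomputable def crossCount {V : Type*} [Fintype V] (G : SimpleGraph V) (S : Finset V) : ℕ :=
  ((S ×ˢ Sᶜ).filter fun e => G.Adj e.1 e.2).card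

/-- Number of crossing edges of a partition `P` of the vertex set:
edges whose two endpoints lie in different parts of `P`. -/
noncomputable def partCross {V : Type*} [Fintype V] (G : SimpleGraph V)
    (P : Finpartition (Finset.univ : Finset V)) : ℕ :=
  (G.edgeFinset.filter fun e => ∀ t ∈ P.parts, ¬ ∀ v ∈ e, v ∈ t).card

/-- Probability that the Erdős–Rényi random graph `G(n,p)` satisfies `Q`. -/
noncomputable def grProb (n : ℕ) (p : ℝ) (Q : SimpleGraph (Fin n) → Prop) : ℝ :=
  ∑ G : SimpleGraph (Fin n),
    if Q G then p ^ edgeCount G * (1 - p) ^ (n.choose 2 - edgeCount G) else 0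

namespace NashWilliamsTutte

open SimpleGraph

variable {V : Type*}

/-- If a new edge joins the components of `u` and `v`, any newly connected pair lies in these. -/
lemma reachable_or_of_reachable_sup_edge {G : SimpleGraph V} {u v a b : V}
    (h : (G ⊔ edge u v).Reachable a b) :
    G.Reachable a b ∨ ((G.Reachable a u ∨ G.Reachable a v) ∧
      (G.Reachable b u ∨ G.Reachable b v)) := by
  obtain ⟨p⟩ := h
  induction p with
  | nil => exact .inl .rfl
  | @cons a c b hac p ih =>
    rw [sup_adj, edge_adj] at hac
    rcases hac with hac | ⟨⟨rfl, rfl⟩ | ⟨rfl, rfl⟩, -⟩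
    · have := hac.reachable
      rcases ih with ih | ⟨ih | ih, ih'⟩
      · exact .inl (this.trans ih)
      · exact .inr ⟨.inl (this.trans ih), ih'⟩
      · exact .inr ⟨.inr (this.trans ih), ih'⟩
    · rcases ih with ih | ⟨-, ih⟩
      · exact .inr ⟨.inl .rfl, .inr ih.symm⟩
      · exact .inr ⟨.inl .rfl, ih⟩
    · rcases ih with ih | ⟨-, ih⟩
      · exact .inr ⟨.inr .rfl, .inl ih.symm⟩
      · exact .inr ⟨.inr .rfl, ih⟩

lemma card_connectedComponent_le_sup_edge [Finite V] (G : SimpleGraph V) (u v : V) :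
    Nat.card G.ConnectedComponent ≤ Nat.card (G ⊔ edge u v).ConnectedComponent + 1 := by
  rw [← Finite.card_option]
  refine Nat.card_le_card_of_injective
    (fun C => if C = G.connectedComponentMk v then none
      else some (C.map (Hom.ofLE le_sup_left))) fun C D => ?_
  induction C, D using ConnectedComponent.ind₂ with
  | _ a b =>
    dsimp only
    split_ifs with ha hb hb
    · intro; rw [ha, hb]
    · simp
    · simp
    · intro h
      have h : (G ⊔ edge u v).Reachable a b := by simpa using h
      rw [ConnectedComponent.eq] at ha hb ⊢
      rcases reachable_or_of_reachable_sup_edge h with h | ⟨h, h'⟩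
      · exact h
      · exact (h.resolve_right ha).trans (h'.resolve_right hb).symm

lemma card_connectedComponent_le_union [Finite V] (T : Set (Sym2 V)) (S : Finset (Sym2 V)) :
    Nat.card (fromEdgeSet T).ConnectedComponent ≤
      Nat.card (fromEdgeSet (T ∪ S)).ConnectedComponent + S.card := by
  induction S using Finset.induction_on with
  | empty => simp
  | insert e S he ih =>
    rw [Finset.card_insert_of_notMem he]
    induction e with
    | _ u v =>
      have h := card_connectedComponent_le_sup_edge (fromEdgeSet (T ∪ S)) u v
      rw [edge, ← fromEdgeSet_union, Set.union_assoc] at h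
      have : (↑S ∪ {s(u, v)} : Set (Sym2 V)) = ↑(insert s(u, v) S) := by
        simp
      rw [this] at h
      omega

/-- The graph formed by the edges of colour `i`. -/
def colorGraph {ι : Type*} (c : Sym2 V → Option ι) (i : ι) : SimpleGraph V :=
  fromEdgeSet {e | c e = some i}

/-- A partial edge colouring whose colour classes are forests of `G`. -/
structure IsForestPacking {ι : Type*} (G : SimpleGraph V) (c : Sym2 V → Option ι) : Prop where
  mem_edgeSet : ∀ e i, c e = some i → e ∈ G.edgeSet
  isAcyclic : ∀ i, (colorGraph c i).IsAcyclic

/-- The number of coloured edges. -/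
noncomputable def packingSize {ι : Type*} [Fintype V] (c : Sym2 V → Option ι) : ℕ :=
  (Finset.univ.filter fun e => c e ≠ none).card

/-- Colour an uncoloured edge `e` with a colour `i` and uncolour an edge `e'` of colour `i`. -/
def Exchange {ι : Type*} (G : SimpleGraph V) (c d : Sym2 V → Option ι) : Prop :=
  ∃ e ∈ G.edgeSet, ∃ i e', c e = none ∧ c e' = some i ∧
    d = Function.update (Function.update c e (some i)) e' none ∧ IsForestPacking G d

/-- The edges left uncoloured by some colouring obtained from `c` by exchanges. -/
def freeEdges {ι : Type*} (G : SimpleGraph V) (c : Sym2 V → Option ι) : Set (Sym2 V) :=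
  {e | e ∈ G.edgeSet ∧ ∃ c', Relation.ReflTransGen (Exchange G) c c' ∧ c' e = none}

section Exchange

variable {ι : Type*} {G : SimpleGraph V} {c c' : Sym2 V → Option ι}

lemma colorGraph_edgeSet (hc : IsForestPacking G c) (i : ι) :
    (colorGraph c i).edgeSet = {e | c e = some i} := by
  rw [colorGraph, edgeSet_fromEdgeSet]
  ext e
  simp only [Set.mem_sdiff, Set.mem_ofPred_eq, and_iff_left_iff_imp]
  exact fun he => G.not_isDiag_of_mem_edgeSet (hc.mem_edgeSet e i he)

lemma isForestPacking_of_exchange (hc : IsForestPacking G c)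
    (h : Relation.ReflTransGen (Exchange G) c c') : IsForestPacking G c' := by
  induction h with
  | refl => exact hc
  | tail _ h _ => obtain ⟨_, _, _, _, _, _, _, h⟩ := h; exact h

lemma packingSize_update_some [Fintype V] {e : Sym2 V} (he : c e = none) (i : ι) :
    packingSize (Function.update c e (some i)) = packingSize c + 1 := by
  have : (Finset.univ.filter fun f => Function.update c e (some i) f ≠ none) =
      insert e (Finset.univ.filter fun f => c f ≠ none) := by
    ext f
    by_cases hf : f = e <;> simp [Function.update_apply, hf]
  rw [packingSize, this, Finset.card_insert_of_notMem (by simp [he]), packingSize]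

lemma packingSize_exchange [Fintype V] (h : Exchange G c c') : packingSize c' = packingSize c := by
  obtain ⟨e, -, i, e', he, he', rfl, -⟩ := h
  have hne : e' ≠ e := by rintro rfl; simp [he] at he'
  have h1 := packingSize_update_some
    (c := Function.update (Function.update c e (some i)) e' none) (e := e') (by simp) i
  have h2 : Function.update (Function.update (Function.update c e (some i)) e' none) e' (some i) =
      Function.update c e (some i) := by
    ext1 f
    by_cases hf : f = e' <;> simp_all [Function.update_apply]
  rw [h2, packingSize_update_some he] at h1
  omega

lemma packingSize_reflTransGen [Fintype V] (h : Relation.ReflTransGen (Exchange G) c c') :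
    packingSize c' = packingSize c := by
  induction h with
  | refl => rfl
  | tail _ h ih => rw [packingSize_exchange h, ih]

/-- In a maximum packing, an uncoloured edge is spanned by every colour class. -/
lemma reachable_colorGraph [Fintype V] (hc : IsForestPacking G c)
    (hmax : ∀ d : Sym2 V → Option ι, IsForestPacking G d → packingSize d ≤ packingSize c)
    {x y : V} (hxy : s(x, y) ∈ G.edgeSet) (hn : c s(x, y) = none) (i : ι) :
    (colorGraph c i).Reachable x y := by
  by_contra hr
  have := hmax (Function.update c s(x, y) (some i)) ⟨fun e j he => ?_, fun j => ?_⟩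
  · rw [packingSize_update_some hn] at this
    omega
  · by_cases h : e = s(x, y)
    · exact h ▸ hxy
    · exact hc.mem_edgeSet e j (by simpa [h] using he)
  · by_cases hj : j = i
    · subst hj
      refine ((hc.isAcyclic j).sup_edge_of_not_reachable hr).anti ?_
      rw [colorGraph, colorGraph, edge, ← fromEdgeSet_union]
      refine fromEdgeSet_mono fun e he => ?_
      by_cases h : e = s(x, y) <;> simp_all
    · refine (hc.isAcyclic j).anti (fromEdgeSet_mono fun e he => ?_)
      by_cases h : e = s(x, y)
      · simp [h, Ne.symm hj] at he
      · simpa [h] using he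

/-- Uncolouring an edge that separates the ends of `s(x, y)` in its colour class allows one to
colour `s(x, y)` instead. -/
lemma exchange_of_not_reachable (hc : IsForestPacking G c) {x y : V} (hxy : s(x, y) ∈ G.edgeSet)
    (hn : c s(x, y) = none) {i : ι} {e' : Sym2 V} (he' : c e' = some i)
    (hr : ¬ ((colorGraph c i).deleteEdges {e'}).Reachable x y) :
    Exchange G c (Function.update (Function.update c s(x, y) (some i)) e' none) := by
  refine ⟨s(x, y), hxy, i, e', hn, he', rfl, fun e j he => ?_, fun j => ?_⟩
  · by_cases hee : e = e'
    · simp [hee] at he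
    by_cases h : e = s(x, y)
    · exact h ▸ hxy
    · exact hc.mem_edgeSet e j (by simpa [h, hee] using he)
  · by_cases hj : j = i
    · subst hj
      refine (((hc.isAcyclic j).anti (deleteEdges_le _)).sup_edge_of_not_reachable hr).anti ?_
      rw [colorGraph, colorGraph, deleteEdges, ← fromEdgeSet_sdiff, edge, ← fromEdgeSet_union]
      refine fromEdgeSet_mono fun e he => ?_
      by_cases hee : e = e'
      · simp [hee] at he
      by_cases h : e = s(x, y) <;> simp_all
    · refine (hc.isAcyclic j).anti (fromEdgeSet_mono fun e he => ?_)
      by_cases hee : e = e'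
      · simp [hee] at he
      by_cases h : e = s(x, y)
      · simp [h] at he
        grind
      · simpa [h, hee] using he

/-- An edge left uncoloured after some exchanges is spanned by the free edges of each colour. -/
lemma reachable_inter_freeEdges [Fintype V] (hc : IsForestPacking G c)
    (hmax : ∀ d : Sym2 V → Option ι, IsForestPacking G d → packingSize d ≤ packingSize c)
    (h : Relation.ReflTransGen (Exchange G) c c')
    {x y : V} (hxy : s(x, y) ∈ G.edgeSet) (hn : c' s(x, y) = none) (i : ι) :
    (fromEdgeSet ({e | c' e = some i} ∩ freeEdges G c)).Reachable x y := by
  have hc' := isForestPacking_of_exchange hc h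
  obtain ⟨p, hp⟩ := (reachable_colorGraph hc'
    (by rwa [packingSize_reflTransGen h]) hxy hn i).exists_isPath
  refine ⟨p.transfer _ fun e he => ?_⟩
  have heG := p.edges_subset_edgeSet he
  have hei : c' e = some i := by rwa [colorGraph_edgeSet hc'] at heG
  rw [edgeSet_fromEdgeSet]
  refine ⟨⟨hei, hc'.mem_edgeSet e i hei, _, h.tail (exchange_of_not_reachable hc' hxy hn hei ?_),
    by simp⟩, not_isDiag_of_mem_edgeSet _ heG⟩
  intro hr
  obtain ⟨q, hq⟩ := hr.exists_isPath
  have hpq := ((hc'.isAcyclic i).subsingleton_path x y).elim ⟨p, hp⟩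
    ⟨q.mapLe (deleteEdges_le _), hq.mapLe (deleteEdges_le _)⟩
  have hpq : p = q.mapLe (deleteEdges_le _) := congrArg Subtype.val hpq
  rw [hpq, Walk.edges_mapLe_eq_edges] at he
  have := q.edges_subset_edgeSet he
  simp [edgeSet_deleteEdges] at this

/-- Exchanges do not enlarge the span of the free edges of a given colour. -/
lemma reachable_inter_freeEdges_of_exchange [Fintype V] (hc : IsForestPacking G c)
    (hmax : ∀ d : Sym2 V → Option ι, IsForestPacking G d → packingSize d ≤ packingSize c)
    (h : Relation.ReflTransGen (Exchange G) c c') (i : ι)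
    {x y : V} (hxy : (fromEdgeSet ({e | c' e = some i} ∩ freeEdges G c)).Reachable x y) :
    (fromEdgeSet ({e | c e = some i} ∩ freeEdges G c)).Reachable x y := by
  induction h generalizing x y with
  | refl => exact hxy
  | @tail c₁ c₂ h₁ h₂ ih =>
    apply ih
    obtain ⟨p⟩ := hxy
    induction p with
    | nil => rfl
    | @cons u v w huv p ihp =>
      refine .trans ?_ ihp
      rw [fromEdgeSet_adj] at huv
      obtain ⟨⟨huv, hf⟩, hne⟩ := huv
      obtain ⟨e, he, j, e', hn, he', rfl, -⟩ := h₂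
      by_cases h' : s(u, v) = e'
      · simp [h'] at huv
      by_cases h : s(u, v) = e
      · subst h
        exact reachable_inter_freeEdges hc hmax h₁ he hn i
      · refine Adj.reachable ?_
        rw [fromEdgeSet_adj]
        exact ⟨⟨by simpa [h, h'] using huv, hf⟩, hne⟩

/-- In a maximum packing, the free edges of each colour span all free edges. -/
lemma reachable_of_reachable_freeEdges [Fintype V] (hc : IsForestPacking G c)
    (hmax : ∀ d : Sym2 V → Option ι, IsForestPacking G d → packingSize d ≤ packingSize c) (i : ι)
    {x y : V} (hxy : (fromEdgeSet (freeEdges G c)).Reachable x y) :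
    (fromEdgeSet ({e | c e = some i} ∩ freeEdges G c)).Reachable x y := by
  obtain ⟨p⟩ := hxy
  induction p with
  | nil => rfl
  | @cons u v w huv p ihp =>
    refine .trans ?_ ihp
    rw [fromEdgeSet_adj] at huv
    obtain ⟨⟨huv, c', h, hn⟩, -⟩ := huv
    exact reachable_inter_freeEdges_of_exchange hc hmax h i
      (reachable_inter_freeEdges hc hmax h huv hn i)

end Exchange

variable [Fintype V]

lemma exists_maximum_isForestPacking (G : SimpleGraph V) (ι : Type*) :
    ∃ c : Sym2 V → Option ι, IsForestPacking G c ∧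
      ∀ d : Sym2 V → Option ι, IsForestPacking G d → packingSize d ≤ packingSize c := by
  have hne : {n | ∃ c : Sym2 V → Option ι, IsForestPacking G c ∧ packingSize c = n}.Nonempty := by
    refine ⟨_, fun _ => none, ⟨by simp, fun i => ?_⟩, rfl⟩
    simp [colorGraph]
  have hbdd : BddAbove {n | ∃ c : Sym2 V → Option ι, IsForestPacking G c ∧ packingSize c = n} := by
    refine ⟨Fintype.card (Sym2 V), ?_⟩
    rintro _ ⟨c, -, rfl⟩
    exact Finset.card_le_univ _
  obtain ⟨c, hc, hcn⟩ := Nat.sSup_mem hne hbdd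
  exact ⟨c, hc, fun d hd => hcn ▸ le_csSup hbdd ⟨d, hd, rfl⟩⟩

lemma packingSize_eq_sum {ι : Type*} [Fintype ι] (c : Sym2 V → Option ι) :
    packingSize c = ∑ i, (Finset.univ.filter fun e => c e = some i).card := by
  rw [← Finset.card_biUnion fun i _ j _ hij => ?_, packingSize]
  · congr 1
    ext e
    simp [Option.ne_none_iff_exists']
  · rw [Function.onFun, Finset.disjoint_left]
    intro e he he'
    simp_all

/-- The number of crossing edges of `P` is at least `|P| - 1` for a connected graph. -/
lemma card_parts_le_partCross_add_one {T : SimpleGraph V} (hT : T.Connected)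
    (P : Finpartition (Finset.univ : Finset V)) : P.parts.card ≤ partCross T P + 1 := by
  set S := T.edgeFinset.filter fun e => ∀ t ∈ P.parts, ¬ ∀ v ∈ e, v ∈ t with hS
  have h := card_connectedComponent_le_union (T.edgeSet \ S) S
  have hST : (S : Set (Sym2 V)) ⊆ T.edgeSet := fun e he => by simp [hS] at he; exact he.1
  rw [Set.sdiff_union_of_subset hST, fromEdgeSet_edgeSet] at h
  have hone : Nat.card T.ConnectedComponent = 1 := by
    have := hT.preconnected.subsingleton_connectedComponent
    have := hT.nonempty
    exact Nat.card_of_subsingleton (T.connectedComponentMk hT.nonempty.some)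
  have hconst : ∀ a b, (fromEdgeSet (T.edgeSet \ S)).Reachable a b → P.part a = P.part b := by
    rintro a b ⟨p⟩
    induction p with
    | nil => rfl
    | @cons u v w huv p ih =>
      rw [← ih]
      rw [fromEdgeSet_adj] at huv
      obtain ⟨⟨huv, hn⟩, -⟩ := huv
      simp only [hS, Finset.coe_filter, Set.mem_ofPred_eq, mem_edgeFinset, huv, true_and] at hn
      push Not at hn
      obtain ⟨t, ht, htv⟩ := hn
      rw [P.part_eq_of_mem ht (htv u (by simp)), P.part_eq_of_mem ht (htv v (by simp))]
  have hle : Nat.card P.parts ≤ Nat.card (fromEdgeSet (T.edgeSet \ S)).ConnectedComponent := by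
    refine Nat.card_le_card_of_surjective (fun C => C.lift
      (fun v => (⟨P.part v, P.part_mem.2 (Finset.mem_univ v)⟩ : P.parts))
      fun a b p _ => Subtype.ext (hconst a b ⟨p⟩)) ?_
    rintro ⟨t, ht⟩
    obtain ⟨v, hv⟩ := P.nonempty_of_mem_parts ht
    exact ⟨connectedComponentMk _ v, Subtype.ext (P.part_eq_of_mem ht hv)⟩
  rw [Nat.card_eq_fintype_card, Fintype.card_coe] at hle
  have : S.card = partCross T P := by rw [hS, partCross]
  omega

lemma le_partCross_of_hasDisjSpanningTrees {G : SimpleGraph V} {k : ℕ}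
    (h : HasDisjSpanningTrees G k) (P : Finpartition (Finset.univ : Finset V)) :
    k * (P.parts.card - 1) ≤ partCross G P := by
  obtain ⟨f, hle, htree, hdisj⟩ := h
  calc k * (P.parts.card - 1) = ∑ _i : Fin k, (P.parts.card - 1) := by simp
    _ ≤ ∑ i, partCross (f i) P := Finset.sum_le_sum fun i _ => by
        have := card_parts_le_partCross_add_one (htree i).connected P
        omega
    _ ≤ partCross G P := by
        simp only [partCross]
        rw [← Finset.card_biUnion fun i _ j _ hij => ?_]
        · refine Finset.card_le_card fun e => ?_
          simp only [Finset.mem_biUnion, Finset.mem_univ, true_and, Finset.mem_filter,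
            mem_edgeFinset]
          rintro ⟨i, he, h⟩
          exact ⟨edgeSet_mono (hle i) he, h⟩
        · rw [Function.onFun, Finset.disjoint_left]
          intro e hi hj
          simp only [Finset.mem_filter, mem_edgeFinset] at hi hj
          exact Set.disjoint_left.1 (hdisj i j hij) hi.1 hj.1

/-- The partition of the vertices into the connected components of a graph. -/
noncomputable def componentPartition (H : SimpleGraph V) :
    Finpartition (Finset.univ : Finset V) :=
  Finpartition.ofSetoid H.reachableSetoid

lemma mem_part_componentPartition {H : SimpleGraph V} {a b : V} :
    b ∈ (componentPartition H).part a ↔ H.Reachable a b :=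
  Finpartition.mem_part_ofSetoid_iff_rel

lemma card_connectedComponent_le_card_parts {H D : SimpleGraph V}
    (h : ∀ a b, H.Reachable a b → D.Reachable a b) :
    Nat.card D.ConnectedComponent ≤ (componentPartition H).parts.card := by
  rw [← Fintype.card_coe, ← Nat.card_eq_fintype_card]
  refine Nat.card_le_card_of_injective (fun C => (⟨(componentPartition H).part C.out,
    (componentPartition H).part_mem.2 (Finset.mem_univ _)⟩ : (componentPartition H).parts)) ?_
  intro C C' hCC
  have hCC : (componentPartition H).part C.out = (componentPartition H).part C'.out :=
    congrArg Subtype.val hCC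
  have hmem : C'.out ∈ (componentPartition H).part C.out := by
    rw [hCC]
    exact mem_part_componentPartition.2 .rfl
  rw [← Quot.out_eq C, ← Quot.out_eq C']
  exact ConnectedComponent.sound (h _ _ (mem_part_componentPartition.1 hmem))

/-- In a maximum packing, all edges crossing the partition induced by the free edges are coloured,
and inside the parts every colour class spans. -/
lemma partCross_add_le_packingSize {ι : Type*} [Fintype ι] {G : SimpleGraph V}
    {c : Sym2 V → Option ι} (hc : IsForestPacking G c)
    (hmax : ∀ d : Sym2 V → Option ι, IsForestPacking G d → packingSize d ≤ packingSize c) :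
    partCross G (componentPartition (fromEdgeSet (freeEdges G c))) +
      Fintype.card ι * Fintype.card V ≤ packingSize c +
        Fintype.card ι * (componentPartition (fromEdgeSet (freeEdges G c))).parts.card := by
  set P := componentPartition (fromEdgeSet (freeEdges G c)) with hP
  have hspan (i : ι) : Fintype.card V ≤ P.parts.card +
      (Finset.univ.filter fun e => c e = some i ∧ e ∈ freeEdges G c).card := by
    have h := card_connectedComponent_le_union (V := V) ∅
      (Finset.univ.filter fun e => c e = some i ∧ e ∈ freeEdges G c)
    have hset : (∅ ∪ ↑(Finset.univ.filter fun e => c e = some i ∧ e ∈ freeEdges G c) :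
        Set (Sym2 V)) = {e | c e = some i} ∩ freeEdges G c := by
      ext; simp
    have hbot : Nat.card (fromEdgeSet (∅ : Set (Sym2 V))).ConnectedComponent
        = Fintype.card V := by
      rw [fromEdgeSet_empty, ← Nat.card_eq_fintype_card]
      refine (Nat.card_eq_of_bijective (connectedComponentMk ⊥) ⟨fun a b hab => ?_, ?_⟩).symm
      · simpa using hab
      · exact Quot.mk_surjective
    rw [hset, hbot] at h
    exact h.trans (Nat.add_le_add_right (card_connectedComponent_le_card_parts
      fun a b => reachable_of_reachable_freeEdges hc hmax i) _)
  have hfree : ∀ e, (∀ t ∈ P.parts, ¬ ∀ v ∈ e, v ∈ t) → e ∉ freeEdges G c := by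
    intro e
    induction e with
    | _ u v =>
      intro h hf
      have huv : (fromEdgeSet (freeEdges G c)).Adj u v :=
        (fromEdgeSet_adj _).2 ⟨hf, G.ne_of_adj hf.1⟩
      refine h (P.part u) (P.part_mem.2 (Finset.mem_univ u)) fun w hw => ?_
      rcases Sym2.mem_iff.1 hw with rfl | rfl
      · exact mem_part_componentPartition.2 .rfl
      · exact mem_part_componentPartition.2 huv.reachable
  have hcross : partCross G P +
      ∑ i, (Finset.univ.filter fun e => c e = some i ∧ e ∈ freeEdges G c).card ≤
        packingSize c := by
    rw [← Finset.card_biUnion fun i _ j _ hij => ?_, partCross,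
      ← Finset.card_union_of_disjoint, packingSize]
    · refine Finset.card_le_card fun e => ?_
      simp only [Finset.mem_union, Finset.mem_biUnion, Finset.mem_univ, true_and,
        Finset.mem_filter, mem_edgeFinset]
      rintro (⟨he, h⟩ | ⟨i, hi, -⟩) hn
      · exact hfree e h ⟨he, c, .refl, hn⟩
      · simp [hi] at hn
    · rw [Finset.disjoint_left]
      intro e he he'
      simp only [Finset.mem_biUnion, Finset.mem_filter] at he he'
      obtain ⟨i, -, -, -, hf⟩ := he'
      exact hfree e he.2 hf
    · rw [Function.onFun, Finset.disjoint_left]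
      intro e he he'
      simp_all
  have := Finset.sum_le_sum fun i (_ : i ∈ Finset.univ) => hspan i
  simp only [Finset.sum_add_distrib, Finset.sum_const, Finset.card_univ, smul_eq_mul] at this
  omega

lemma card_edgeFinset_add_one_le_of_isAcyclic [Nonempty V] {F : SimpleGraph V}
    (hF : F.IsAcyclic) : F.edgeFinset.card + 1 ≤ Fintype.card V := by
  obtain ⟨T, hFT, -, hT⟩ := connected_top.exists_isTree_le_of_le_of_isAcyclic le_top hF
  rw [← hT.card_edgeFinset]
  exact Nat.add_le_add_right (Finset.card_le_card (edgeFinset_mono hFT)) 1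

lemma isTree_of_isAcyclic_of_card_edgeFinset [Nonempty V] {F : SimpleGraph V}
    (hF : F.IsAcyclic) (h : F.edgeFinset.card + 1 = Fintype.card V) : F.IsTree := by
  obtain ⟨T, hFT, -, hT⟩ := connected_top.exists_isTree_le_of_le_of_isAcyclic le_top hF
  have hcard := hT.card_edgeFinset
  rwa [edgeFinset_inj.1 (Finset.eq_of_subset_of_card_le (edgeFinset_mono hFT) (by omega))]

end NashWilliamsTutte

open NashWilliamsTutte

theorem nash_williams_tutte {V : Type*} [Fintype V] [Nonempty V]
    (G : SimpleGraph V) (k : ℕ) :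
    HasDisjSpanningTrees G k ↔
      ∀ P : Finpartition (Finset.univ : Finset V),
        k * (P.parts.card - 1) ≤ partCross G P := by
  refine ⟨le_partCross_of_hasDisjSpanningTrees, fun h => ?_⟩
  obtain ⟨c, hc, hmax⟩ := exists_maximum_isForestPacking G (Fin k)
  have hcard := partCross_add_le_packingSize hc hmax
  set P := componentPartition (SimpleGraph.fromEdgeSet (freeEdges G c))
  have hP := h P
  have hpos : 1 ≤ P.parts.card :=
    Finset.card_pos.2 (P.parts_nonempty (Finset.univ_nonempty.ne_empty))
  have hsize : packingSize c = ∑ i, (colorGraph c i).edgeFinset.card := by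
    rw [packingSize_eq_sum]
    refine Finset.sum_congr rfl fun i _ => congrArg Finset.card ?_
    ext e
    simp [colorGraph_edgeSet hc]
  have hsum : ∑ _i : Fin k, Fintype.card V ≤ ∑ i, ((colorGraph c i).edgeFinset.card + 1) := by
    rw [Finset.sum_add_distrib, ← hsize]
    simp only [Finset.sum_const, Finset.card_univ, Fintype.card_fin, smul_eq_mul, mul_one]
      at hcard ⊢
    obtain ⟨m, hm⟩ := Nat.exists_eq_add_of_le' hpos
    rw [hm] at hcard hP
    simp only [Nat.add_sub_cancel, mul_add, mul_one] at hcard hP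
    omega
  have hle (i : Fin k) (_ : i ∈ Finset.univ) :=
    card_edgeFinset_add_one_le_of_isAcyclic (hc.isAcyclic i)
  have heq := (Finset.sum_eq_sum_iff_of_le hle).1 (le_antisymm (Finset.sum_le_sum hle) hsum)
  refine ⟨colorGraph c, fun i => ?_, fun i =>
    isTree_of_isAcyclic_of_card_edgeFinset (hc.isAcyclic i) (heq i (Finset.mem_univ i)),
    fun i j hij => ?_⟩
  · rw [← SimpleGraph.edgeSet_subset_edgeSet, colorGraph_edgeSet hc]
    exact fun e => hc.mem_edgeSet e i
  · rw [colorGraph_edgeSet hc, colorGraph_edgeSet hc, Set.disjoint_left]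
    intro e he he'
    simp_all
end

section
/- For p = p(n) with np - log n → ∞ and p ≤ (1.1 log n)/n, asymptotically almost surely the random graph G ~ G(n,p) contains δ(G) pairwise edge-disjoint spanning trees; equivalently, σ(G) = δ(G) a.a.s. -/
open scoped Classical
open Filter

open Finset in
theorem exists_max_packing_closed {E W 𝕜 : Type*} [Fintype E] [Field 𝕜] [AddCommGroup W]
    [Module 𝕜 W] (v : E → W) (k : ℕ) :
    ∃ (F : Fin k → Finset E) (A : Finset E), Pairwise (fun i j => Disjoint (F i) (F j)) ∧
      (∀ i, LinearIndepOn 𝕜 v (F i : Set E)) ∧ (∀ e, (∀ i, e ∉ F i) → e ∈ A) ∧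
      ∀ i, ∀ e ∈ A, v e ∈ Submodule.span 𝕜 (v '' (F i ∩ A : Set E)) := by
  let IsP : (Fin k → Finset E) → Prop := fun F =>
    Pairwise (fun i j => Disjoint (F i) (F j)) ∧ ∀ i, LinearIndepOn 𝕜 v (F i : Set E)
  have hex : ∃ F, IsP F := ⟨fun _ => ∅, fun _ _ _ => by simp, fun _ => by simp⟩
  obtain ⟨F₀, hF₀, hmax⟩ := Set.exists_max_image {F | IsP F} (fun F => ∑ i, (F i).card)
    (Set.toFinite _) hex
  let step : (Fin k → Finset E) → (Fin k → Finset E) → Prop := fun F F' =>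
    ∃ i e f, (∀ j, e ∉ F j) ∧ f ∈ F i ∧ F' = Function.update F i (insert e ((F i).erase f)) ∧ IsP F'
  have hreach : ∀ F, Relation.ReflTransGen step F₀ F →
      IsP F ∧ ∑ i, (F i).card = ∑ i, (F₀ i).card := by
    intro F hF
    induction hF with
    | refl => exact ⟨hF₀, rfl⟩
    | @tail F F' _ hs ih =>
      obtain ⟨i, e, f, he, hf, rfl, hP⟩ := hs
      refine ⟨hP, ih.2 ▸ Finset.sum_congr rfl fun j _ => ?_⟩
      by_cases hj : j = i
      · subst hj
        rw [Function.update_self, card_insert_of_notMem (by simp [he]), card_erase_add_one hf]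
      · rw [Function.update_of_ne hj]
  -- inserting an uncovered independent element keeps a packing
  have hins : ∀ F : Fin k → Finset E, IsP F → ∀ i e, (∀ j, e ∉ F j) → ∀ S ⊆ F i,
      v e ∉ Submodule.span 𝕜 (v '' (S : Set E)) → IsP (Function.update F i (insert e S)) := by
    intro F hF i e he S hS hsp
    refine ⟨fun a b hab => ?_, fun j => ?_⟩
    · beta_reduce
      by_cases ha : a = i
      · subst ha
        rw [Function.update_self, Function.update_of_ne hab.symm, disjoint_insert_left]
        exact ⟨he b, (hF.1 hab).mono_left hS⟩
      · rw [Function.update_of_ne ha]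
        by_cases hb : b = i
        · subst hb
          rw [Function.update_self, disjoint_insert_right]
          exact ⟨he a, (hF.1 hab).mono_right hS⟩
        · rw [Function.update_of_ne hb]; exact hF.1 hab
    · by_cases hj : j = i
      · subst hj
        rw [Function.update_self, coe_insert]
        exact ((hF.2 j).mono (by exact_mod_cast hS)).insert hsp
      · rw [Function.update_of_ne hj]; exact hF.2 j
  let A : Finset E := univ.filter fun e =>
    ∃ F, Relation.ReflTransGen step F₀ F ∧ ∀ i, e ∉ F i
  have hcirc : ∀ F, Relation.ReflTransGen step F₀ F → ∀ e, (∀ j, e ∉ F j) → ∀ i,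
      v e ∈ Submodule.span 𝕜 (v '' (F i ∩ A : Set E)) := by
    intro F hF e he i
    obtain ⟨hP, hcard⟩ := hreach F hF
    have hin : v e ∈ Submodule.span 𝕜 (v '' (F i : Set E)) := by
      by_contra hcon
      have h1 := hmax _ (hins F hP i e he (F i) subset_rfl hcon)
      have h2 : ∑ j, (Function.update F i (insert e (F i)) j).card = ∑ j, (F j).card + 1 := by
        rw [← Finset.add_sum_erase _ _ (mem_univ i), ← Finset.add_sum_erase univ
          (fun j => (F j).card) (mem_univ i), Function.update_self,
          card_insert_of_notMem (he i)]
        rw [Finset.sum_congr rfl fun j hj => by rw [Function.update_of_ne (ne_of_mem_erase hj)]]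
        ring
      omega
    obtain ⟨c, hc⟩ := (Submodule.mem_span_image_finset_iff_exists_fun' 𝕜).1 hin
    rw [← hc]
    refine Submodule.sum_mem _ fun f hf => ?_
    by_cases hcf : c f = 0
    · simp [hcf]
    refine Submodule.smul_mem _ _ (Submodule.subset_span ⟨f, ⟨hf, ?_⟩, rfl⟩)
    have hnot : v e ∉ Submodule.span 𝕜 (v '' (((F i).erase f : Finset E) : Set E)) := by
      intro hcon
      have hvf : v f ∈ Submodule.span 𝕜 (v '' (((F i).erase f : Finset E) : Set E)) := by
        rw [← Finset.add_sum_erase _ _ hf] at hc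
        have h3 : c f • v f ∈ Submodule.span 𝕜 (v '' (((F i).erase f : Finset E) : Set E)) := by
          rw [eq_sub_of_add_eq hc]
          exact Submodule.sub_mem _ hcon (Submodule.sum_mem _ fun g hg =>
            Submodule.smul_mem _ _ (Submodule.subset_span ⟨g, hg, rfl⟩))
        exact (Submodule.smul_mem_iff _ hcf).1 h3
      have hi := hP.2 i
      rw [← insert_erase hf, coe_insert] at hi
      exact hi.notMem_span_of_insert (by simp) hvf
    refine mem_coe.2 (mem_filter.2 ⟨mem_univ _, _, hF.tail ⟨i, e, f, he, hf, rfl,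
      hins F hP i e he _ (erase_subset _ _) hnot⟩, fun j => ?_⟩)
    by_cases hj : j = i
    · subst hj
      rw [Function.update_self]
      simp only [mem_insert, mem_erase, ne_eq, not_true_eq_false, false_and, or_false]
      rintro rfl; exact he _ hf
    · rw [Function.update_of_ne hj]
      exact fun h => disjoint_left.1 (hP.1 hj) h hf
  have hmono : ∀ F, Relation.ReflTransGen step F₀ F → ∀ i,
      Submodule.span 𝕜 (v '' (F i ∩ A : Set E)) ≤ Submodule.span 𝕜 (v '' (F₀ i ∩ A : Set E)) := by
    intro F hF
    induction hF with
    | refl => exact fun i => le_rfl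
    | @tail F F' hr hs ih =>
      intro j
      refine le_trans ?_ (ih j)
      obtain ⟨i, e, f, he, hf, rfl, hP⟩ := hs
      by_cases hj : j = i
      · subst hj
        rw [Function.update_self, Submodule.span_le]
        rintro _ ⟨g, ⟨hg, hgA⟩, rfl⟩
        simp only [coe_insert, Set.mem_insert_iff, mem_coe, mem_erase] at hg
        rcases hg with rfl | hg
        · exact hcirc F hr _ he j
        · exact Submodule.subset_span ⟨g, ⟨hg.2, hgA⟩, rfl⟩
      · rw [Function.update_of_ne hj]
  refine ⟨F₀, A, hF₀.1, hF₀.2, fun e he => mem_filter.2 ⟨mem_univ _, F₀, .refl, he⟩,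
    fun i e he => ?_⟩
  obtain ⟨F, hF, heF⟩ := (mem_filter.1 he).2
  exact hmono F hF i (hcirc F hF e heF i)

/-- Incidence vector of an edge over the two-element field. -/
noncomputable def edgeVec {V : Type*} (e : Sym2 V) : V → ZMod 2 := fun w => if w ∈ e then 1 else 0

theorem edgeVec_mk {V : Type*} {u w : V} (h : u ≠ w) :
    edgeVec s(u, w) = Pi.single u 1 + Pi.single w 1 := by
  ext x
  by_cases hu : x = u
  · subst hu; simp [edgeVec, h]
  · by_cases hw : x = w
    · subst hw; simp [edgeVec, hu]
    · simp [edgeVec, hu, hw]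

theorem finrank_span_edgeVec_add_card_le {V : Type*} [Fintype V] (S : Set (Sym2 V))
    (hS : ∀ e ∈ S, ¬ e.IsDiag) :
    Module.finrank (ZMod 2) (Submodule.span (ZMod 2) (edgeVec '' S)) +
      Nat.card (SimpleGraph.fromEdgeSet S).ConnectedComponent ≤ Fintype.card V := by
  obtain ⟨T, hT⟩ : ∃ T, T = SimpleGraph.fromEdgeSet S := ⟨_, rfl⟩
  rw [← hT, Nat.card_eq_fintype_card]
  let Φ := Fintype.linearCombination (ZMod 2)
    (fun v => (Pi.single (T.connectedComponentMk v) 1 : T.ConnectedComponent → ZMod 2))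
  have hΦ : ∀ v, Φ (Pi.single v 1) = Pi.single (T.connectedComponentMk v) 1 := fun v => by
    simp [Φ, Fintype.linearCombination_apply_single]
  have hsurj : LinearMap.range Φ = ⊤ := by
    rw [eq_top_iff, ← (Pi.basisFun (ZMod 2) T.ConnectedComponent).span_eq, Submodule.span_le]
    rintro _ ⟨c, rfl⟩
    refine ⟨Pi.single c.out 1, ?_⟩
    rw [hΦ, Pi.basisFun_apply]
    exact congrArg (fun d : T.ConnectedComponent => (Pi.single d 1 : _ → ZMod 2)) (Quot.out_eq c)
  have hker : Submodule.span (ZMod 2) (edgeVec '' S) ≤ LinearMap.ker Φ := by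
    rw [Submodule.span_le]
    rintro _ ⟨e, he, rfl⟩
    induction e with | _ u w
    have hne : u ≠ w := fun h => hS _ he (by simp [h])
    have hc : T.connectedComponentMk u = T.connectedComponentMk w :=
      SimpleGraph.ConnectedComponent.sound
        (SimpleGraph.Adj.reachable (hT ▸ (SimpleGraph.fromEdgeSet_adj S).2 ⟨he, hne⟩))
    rw [SetLike.mem_coe, LinearMap.mem_ker, edgeVec_mk hne, map_add, hΦ, hΦ, hc]
    exact funext fun _ => CharTwo.add_self_eq_zero _
  have h1 := LinearMap.finrank_range_add_finrank_ker Φ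
  rw [hsurj, finrank_top, Module.finrank_fintype_fun_eq_card,
    Module.finrank_fintype_fun_eq_card] at h1
  have h2 := Submodule.finrank_mono hker
  omega

theorem card_le_finrank_span_edgeVec_add {V : Type*} [Fintype V] (S : Set (Sym2 V)) :
    Fintype.card V ≤ Module.finrank (ZMod 2) (Submodule.span (ZMod 2) (edgeVec '' S)) +
      Nat.card (SimpleGraph.fromEdgeSet S).ConnectedComponent := by
  obtain ⟨T, hT⟩ : ∃ T, T = SimpleGraph.fromEdgeSet S := ⟨_, rfl⟩
  rw [← hT, Nat.card_eq_fintype_card]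
  set U := Submodule.span (ZMod 2) (edgeVec '' S)
  have hreach : ∀ u w, T.Reachable u w →
      U.mkQ (Pi.single u 1) = U.mkQ (Pi.single w 1) := by
    rintro u w ⟨q⟩
    induction q with
    | nil => rfl
    | @cons a b c hab q ih =>
      rw [← ih]
      obtain ⟨h1, h2⟩ := (SimpleGraph.fromEdgeSet_adj S).1 (hT ▸ hab)
      rw [← sub_eq_zero, ← map_sub, Submodule.mkQ_apply, Submodule.Quotient.mk_eq_zero,
        show (Pi.single a 1 - Pi.single b 1 : V → ZMod 2) = Pi.single a 1 + Pi.single b 1 from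
          funext fun _ => CharTwo.sub_eq_add _ _, ← edgeVec_mk h2]
      exact Submodule.subset_span ⟨_, h1, rfl⟩
  have hspan : Submodule.span (ZMod 2) (Set.range fun c : T.ConnectedComponent =>
      U.mkQ (Pi.single c.out 1)) = ⊤ := by
    rw [eq_top_iff, ← Submodule.range_mkQ U, LinearMap.range_eq_map,
      ← (Pi.basisFun (ZMod 2) V).span_eq, Submodule.map_span, Submodule.span_le]
    rintro _ ⟨_, ⟨v, rfl⟩, rfl⟩
    refine Submodule.subset_span ⟨T.connectedComponentMk v, ?_⟩
    rw [Pi.basisFun_apply]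
    exact hreach _ _ (SimpleGraph.ConnectedComponent.exact (Quot.out_eq _))
  have h1 := finrank_range_le_card (R := ZMod 2) (fun c : T.ConnectedComponent =>
      U.mkQ (Pi.single c.out 1))
  rw [Set.finrank, hspan, finrank_top] at h1
  have h2 := U.finrank_quotient_add_finrank
  rw [Module.finrank_fintype_fun_eq_card] at h2
  omega

/-- The number of edges of `G` whose end points receive different labels. -/
noncomputable def labelCross {V : Type*} [Fintype V] (G : SimpleGraph V) (c : V → V) : ℕ :=
  (G.edgeFinset.filter fun e => ∃ u ∈ e, ∃ w ∈ e, c u ≠ c w).card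

/-- The sufficient direction of the Nash-Williams–Tutte theorem. -/
theorem hasDisjSpanningTrees_of_labelCross {V : Type*} [Fintype V] [Nonempty V]
    (G : SimpleGraph V) (k : ℕ)
    (h : ∀ c : V → V, k * ((Finset.univ.image c).card - 1) ≤ labelCross G c) :
    HasDisjSpanningTrees G k := by
  obtain ⟨F, A, hdisj, hind, hA, hspan⟩ := exists_max_packing_closed (𝕜 := ZMod 2)
    (fun e : G.edgeSet => edgeVec (e : Sym2 V)) k
  let val : G.edgeSet → Sym2 V := Subtype.val
  let T : Finset G.edgeSet → SimpleGraph V := fun B => SimpleGraph.fromEdgeSet (val '' (B : Set G.edgeSet))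
  have himg : ∀ B : Set G.edgeSet, (fun e : G.edgeSet => edgeVec (e : Sym2 V)) '' B =
    edgeVec '' (val '' B) := fun B => by rw [Set.image_image]
  set r := Module.finrank (ZMod 2) (Submodule.span (ZMod 2) (edgeVec '' (val '' (A : Set G.edgeSet)))) with hr
  have hrank : ∀ B : Finset G.edgeSet,
      LinearIndepOn (ZMod 2) (fun e : G.edgeSet => edgeVec (e : Sym2 V)) (B : Set G.edgeSet) →
      Module.finrank (ZMod 2) (Submodule.span (ZMod 2) (edgeVec '' (val '' (B : Set G.edgeSet)))) = B.card := by
    intro B hB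
    have := finrank_span_eq_card hB
    rw [← himg, Set.image_eq_range]
    simpa using this
  have hFA : ∀ i, (F i ∩ A).card = r := by
    intro i
    rw [← hrank _ ((hind i).mono (by simp)), hr, ← himg, ← himg]
    suffices hs : Submodule.span (ZMod 2) ((fun e : G.edgeSet => edgeVec (e : Sym2 V)) ''
        (F i ∩ A : Finset G.edgeSet)) = Submodule.span (ZMod 2)
        ((fun e : G.edgeSet => edgeVec (e : Sym2 V)) '' A) by rw [hs]
    apply le_antisymm
    · exact Submodule.span_mono (Set.image_mono (by simp))
    · rw [Submodule.span_le]
      rintro _ ⟨e, he, rfl⟩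
      simpa using hspan i e he
  -- label vertices by the component of the closed part
  let c : V → V := fun v => ((T A).connectedComponentMk v).out
  have hcimg : (Finset.univ.image c).card = Fintype.card (T A).ConnectedComponent := by
    have : Finset.univ.image c = Finset.univ.image
        (fun d : (T A).ConnectedComponent => d.out) := by
      ext v
      simp only [Finset.mem_image, Finset.mem_univ, true_and, c]
      constructor
      · rintro ⟨a, rfl⟩; exact ⟨_, rfl⟩
      · rintro ⟨d, rfl⟩; exact ⟨d.out, by
          congr 1; exact Quot.out_eq d⟩
    rw [this, Finset.card_image_of_injective _ (fun a b hab => by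
      rw [← Quot.out_eq a, ← Quot.out_eq b]; exact congrArg _ hab), Finset.card_univ]
  have hcross : labelCross G c ≤ (Finset.univ \ A).card := by
    rw [labelCross, ← Finset.card_image_of_injective (Finset.univ \ A) Subtype.val_injective]
    refine Finset.card_le_card fun e he => ?_
    obtain ⟨heG, u, hu, w, hw, huw⟩ := Finset.mem_filter.1 he
    refine Finset.mem_image.2 ⟨⟨e, SimpleGraph.mem_edgeFinset.1 heG⟩, ?_, rfl⟩
    rw [Finset.mem_sdiff]
    refine ⟨Finset.mem_univ _, fun heA => huw ?_⟩
    have hne : u ≠ w := by rintro rfl; exact huw rfl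
    have heq : e = s(u, w) := ((Sym2.mem_and_mem_iff hne).1 ⟨hu, hw⟩)
    have : (T A).Adj u w := (SimpleGraph.fromEdgeSet_adj _).2 ⟨⟨_, heA, heq⟩, hne⟩
    simp only [c]
    rw [SimpleGraph.ConnectedComponent.sound this.reachable]
  have hcover : (Finset.univ \ A).card ≤ ∑ i, (F i \ A).card := by
    have : Finset.univ \ A ⊆ Finset.univ.biUnion fun i => F i \ A := by
      intro e he
      have heA := (Finset.mem_sdiff.1 he).2
      by_contra hcon
      refine heA (hA e fun i hi => hcon ?_)
      exact Finset.mem_biUnion.2 ⟨i, Finset.mem_univ _, Finset.mem_sdiff.2 ⟨hi, heA⟩⟩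
    exact (Finset.card_le_card this).trans Finset.card_biUnion_le
  have hsum : ∑ i, (F i).card = ∑ i, (F i \ A).card + k * r := by
    rw [Finset.sum_congr rfl fun i _ => (Finset.card_sdiff_add_card_inter (F i) A).symm,
      Finset.sum_add_distrib, Finset.sum_congr rfl fun i _ => hFA i]
    simp
  have hcomp : ∀ i, (F i).card + Fintype.card (T (F i)).ConnectedComponent ≤ Fintype.card V := by
    intro i
    rw [← hrank _ (hind i), ← Nat.card_eq_fintype_card (α := (T (F i)).ConnectedComponent)]
    refine finrank_span_edgeVec_add_card_le _ ?_
    rintro _ ⟨e, _, rfl⟩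
    exact G.not_isDiag_of_mem_edgeSet e.2
  have hpos : ∀ B, 1 ≤ Fintype.card (T B).ConnectedComponent := fun B =>
    Fintype.card_pos
  have hge : k * (Fintype.card V - 1) ≤ ∑ i, (F i).card := by
    have h1 := card_le_finrank_span_edgeVec_add (val '' (A : Set G.edgeSet))
    have h2 := h c
    rw [hcimg] at h2
    have h3 : Fintype.card V - 1 ≤ (Fintype.card (T A).ConnectedComponent - 1) + r := by
      have := hpos A
      change _ ≤ r + Nat.card (T A).ConnectedComponent at h1
      rw [Nat.card_eq_fintype_card] at h1
      omega
    calc k * (Fintype.card V - 1) ≤ k * ((Fintype.card (T A).ConnectedComponent - 1) + r) :=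
          Nat.mul_le_mul_left _ h3
      _ ≤ _ := by rw [mul_add, hsum]; omega
  have hconn : ∀ i, (T (F i)).Connected := by
    intro i
    have hle : ∀ j, (F j).card ≤ Fintype.card V - 1 := fun j => by
      have := hcomp j; have := hpos (F j); omega
    have heq : ∀ j ∈ Finset.univ, (F j).card = Fintype.card V - 1 := by
      rw [← Finset.sum_eq_sum_iff_of_le fun j _ => hle j]
      refine le_antisymm (Finset.sum_le_sum fun j _ => hle j) ?_
      simpa using hge
    have h1 := heq i (Finset.mem_univ _)
    have h2 := hcomp i
    have h3 : Fintype.card (T (F i)).ConnectedComponent ≤ 1 := by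
      have : 0 < Fintype.card V := Fintype.card_pos
      omega
    have h4 := Fintype.card_le_one_iff_subsingleton.1 h3
    exact ⟨fun u w => SimpleGraph.ConnectedComponent.exact (h4.elim _ _)⟩
  choose f hfle hftree using fun i => (hconn i).exists_isTree_le
  refine ⟨f, fun i => (hfle i).trans ?_, hftree, fun i j hij => ?_⟩
  · intro u w huw
    obtain ⟨⟨e, -, he⟩, -⟩ := (SimpleGraph.fromEdgeSet_adj _).1 huw
    have := e.2
    rw [show (e : Sym2 V) = s(u, w) from he] at this
    exact this
  · have hsub : ∀ i, (f i).edgeSet ⊆ val '' (F i : Set G.edgeSet) := fun i =>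
      (SimpleGraph.edgeSet_mono (hfle i)).trans
        (by rw [SimpleGraph.edgeSet_fromEdgeSet]; exact Set.sdiff_subset)
    refine Set.disjoint_of_subset (hsub i) (hsub j) ?_
    rw [Set.disjoint_image_iff Subtype.val_injective]
    exact_mod_cast hdisj hij

theorem HasDisjSpanningTrees.le_minDegree {V : Type*} [Fintype V] [Nontrivial V]
    {G : SimpleGraph V} {k : ℕ} (h : HasDisjSpanningTrees G k) : k ≤ G.minDegree := by
  obtain ⟨f, hle, htree, hdisj⟩ := h
  obtain ⟨v, hv⟩ := G.exists_minimal_degree_vertex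
  have hnb : ∀ i, ∃ w, (f i).Adj v w := fun i =>
    (SimpleGraph.degree_pos_iff_exists_adj (f i) v).1
      ((htree i).1.preconnected.degree_pos_of_nontrivial v)
  choose w hw using hnb
  rw [hv, ← SimpleGraph.card_neighborFinset_eq_degree]
  have := Finset.card_le_card_of_injOn (s := (Finset.univ : Finset (Fin k)))
    (t := G.neighborFinset v) w (fun i _ => by simpa using hle i (hw i)) (by
      intro i _ j _ hij
      by_contra hne
      exact Set.disjoint_left.1 (hdisj i j hne)
        (show s(v, w i) ∈ (f i).edgeSet from hw i) (by rw [hij]; exact hw j))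
  simpa using this

theorem stp_eq_minDegree {V : Type*} [Fintype V] [Nontrivial V] {G : SimpleGraph V}
    (h : HasDisjSpanningTrees G G.minDegree) : stp G = G.minDegree :=
  IsGreatest.csSup_eq ⟨h, fun _ hk => HasDisjSpanningTrees.le_minDegree hk⟩

theorem sum_card_adj_eq_two_mul {V : Type*} [Fintype V] (G : SimpleGraph V)
    (Q : Sym2 V → Prop) :
    ∑ u, (Finset.univ.filter fun w => G.Adj u w ∧ Q s(u, w)).card =
      2 * (G.edgeFinset.filter Q).card := by
  let H : SimpleGraph V :=
    { Adj := fun u w => G.Adj u w ∧ Q s(u, w)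
      symm := ⟨fun u w h => ⟨h.1.symm, by rw [Sym2.eq_swap]; exact h.2⟩⟩
      loopless := ⟨fun u h => G.loopless.irrefl u h.1⟩ }
  have h1 := H.sum_degrees_eq_twice_card_edges
  have h2 : H.edgeFinset = G.edgeFinset.filter Q := by
    ext e
    induction e with | _ u w
    simp [H]
  rw [h2] at h1
  rw [← h1]
  refine Finset.sum_congr rfl fun u _ => ?_
  rw [← SimpleGraph.card_neighborFinset_eq_degree]
  congr 1
  ext w
  simp [H]

theorem degree_eq_card_filter {V : Type*} [Fintype V] (G : SimpleGraph V) (u : V) :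
    G.degree u = (Finset.univ.filter fun w => G.Adj u w).card := by
  rw [← SimpleGraph.card_neighborFinset_eq_degree]
  congr 1
  ext w
  simp

theorem sum_card_adj_comm {V : Type*} [Fintype V] (G : SimpleGraph V) (S T : Finset V) :
    ∑ u ∈ S, (T.filter fun w => G.Adj u w).card = ∑ w ∈ T, (S.filter fun u => G.Adj w u).card := by
  simp only [Finset.card_filter]
  rw [Finset.sum_comm]
  simp only [G.adj_comm]

/-- Expansion properties, with degree threshold `K`, density bound `C` and size threshold `M`,
that force a packing of `d` spanning trees. -/
structure Expands {V : Type*} [Fintype V] (G : SimpleGraph V) (K C M d : ℕ) : Prop where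
  le_degree : ∀ v, d ≤ G.degree v
  threshold : 2 * d + 2 * C + 1 ≤ K
  low_not_adj : ∀ u v, G.degree u ≤ K → G.degree v ≤ K → ¬ G.Adj u v
  low_common : ∀ w u v, G.degree u ≤ K → G.degree v ≤ K → u ≠ v → G.Adj w u → ¬ G.Adj w v
  sparse : ∀ S : Finset V, S.card ≤ M →
    ∑ u ∈ S, (S.filter fun w => G.Adj u w).card ≤ 2 * C * S.card
  cut : ∀ S : Finset V, M < S.card → 2 * S.card ≤ Fintype.card V → 2 * S.card ≤ crossCount G S
  two_mul_le : 2 * d ≤ M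

theorem crossCount_eq_sum {V : Type*} [Fintype V] (G : SimpleGraph V) (S : Finset V) :
    crossCount G S = ∑ u ∈ S, (Sᶜ.filter fun w => G.Adj u w).card := by
  rw [crossCount, Finset.card_filter, Finset.sum_product]
  simp only [Finset.card_filter]

theorem Expands.two_mul_le_boundary {V : Type*} [Fintype V] {G : SimpleGraph V} {K C M d : ℕ}
    (h : Expands G K C M d) (S L : Finset V) (hS : S.Nonempty) (hn : 2 * S.card ≤ Fintype.card V)
    (hL : ∀ v ∈ L, G.degree v ≤ K)
    (hsing : ∀ v, S = {v} → K < G.degree v) :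
    2 * d ≤ ∑ u ∈ S, (Finset.univ.filter fun w => G.Adj u w ∧ w ∉ L ∧ w ∉ S).card := by
  set g : V → ℕ := fun u => (Finset.univ.filter fun w => G.Adj u w ∧ w ∉ L ∧ w ∉ S).card with hg
  have hone : ∀ u, (Finset.univ.filter fun w => G.Adj u w ∧ G.degree w ≤ K).card ≤ 1 := by
    intro u
    rw [Finset.card_le_one]
    intro a ha b hb
    simp only [Finset.mem_filter, Finset.mem_univ, true_and] at ha hb
    by_contra hab
    exact h.low_common u a b ha.2 hb.2 hab ha.1 hb.1
  by_cases hM : M < S.card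
  · have h1 := h.cut S hM hn
    rw [crossCount_eq_sum] at h1
    have h2 : ∀ u ∈ S, (Sᶜ.filter fun w => G.Adj u w).card ≤ g u + 1 := by
      intro u _
      refine le_trans ?_ (Nat.add_le_add_left (hone u) _)
      refine le_trans (Finset.card_le_card ?_) (Finset.card_union_le _ _)
      intro w hw
      simp only [Finset.mem_filter, Finset.mem_compl, Finset.mem_union, Finset.mem_univ,
        true_and] at hw ⊢
      by_cases hwL : w ∈ L
      · exact Or.inr ⟨hw.2, hL w hwL⟩
      · exact Or.inl ⟨hw.2, hwL, hw.1⟩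
    have h3 := Finset.sum_le_sum h2
    rw [Finset.sum_add_distrib] at h3
    simp only [Finset.sum_const, smul_eq_mul, mul_one] at h3
    have := h.two_mul_le
    change 2 * d ≤ ∑ u ∈ S, g u
    omega
  · set H := S.filter fun v => K < G.degree v with hH
    set Lo := S.filter fun v => ¬ K < G.degree v with hLo
    have hsplit : ∑ u ∈ S, g u = ∑ u ∈ H, g u + ∑ u ∈ Lo, g u :=
      (Finset.sum_filter_add_sum_filter_not _ _ _).symm
    have hhigh : ∀ u ∈ H, K ≤ g u + (H.filter fun w => G.Adj u w).card := by
      intro u hu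
      have h1 : K < G.degree u := (Finset.mem_filter.1 hu).2
      rw [degree_eq_card_filter] at h1
      have h2 : (Finset.univ.filter fun w => G.Adj u w) ⊆
          (Finset.univ.filter fun w => G.Adj u w ∧ w ∉ L ∧ w ∉ S) ∪
          (H.filter fun w => G.Adj u w) ∪
          (Finset.univ.filter fun w => G.Adj u w ∧ G.degree w ≤ K) := by
        intro w hw
        simp only [Finset.mem_filter, Finset.mem_union, Finset.mem_univ, true_and, hH] at hw ⊢
        by_cases hwK : G.degree w ≤ K
        · exact Or.inr ⟨hw, hwK⟩
        · have hwL : w ∉ L := fun hh => hwK (hL w hh)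
          by_cases hwS : w ∈ S
          · exact Or.inl (Or.inr ⟨⟨hwS, not_le.1 hwK⟩, hw⟩)
          · exact Or.inl (Or.inl ⟨hw, hwL, hwS⟩)
      have h3 := Finset.card_le_card h2
      have h4 := Finset.card_union_le ((Finset.univ.filter fun w => G.Adj u w ∧ w ∉ L ∧ w ∉ S) ∪
          (H.filter fun w => G.Adj u w))
          (Finset.univ.filter fun w => G.Adj u w ∧ G.degree w ≤ K)
      have h5 := Finset.card_union_le (Finset.univ.filter fun w => G.Adj u w ∧ w ∉ L ∧ w ∉ S)
          (H.filter fun w => G.Adj u w)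
      have h6 := hone u
      simp only [hg]
      omega
    have hlow : ∀ u ∈ Lo, d ≤ g u + (H.filter fun w => G.Adj u w).card := by
      intro u hu
      have huK : G.degree u ≤ K := not_lt.1 (Finset.mem_filter.1 hu).2
      refine (h.le_degree u).trans ?_
      rw [degree_eq_card_filter]
      refine le_trans (Finset.card_le_card ?_) (Finset.card_union_le _ _)
      intro w hw
      simp only [Finset.mem_filter, Finset.mem_union, Finset.mem_univ, true_and, hH] at hw ⊢
      have hwK : ¬ G.degree w ≤ K := fun hh => h.low_not_adj u w huK hh hw
      by_cases hwS : w ∈ S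
      · exact Or.inr ⟨⟨hwS, not_le.1 hwK⟩, hw⟩
      · exact Or.inl ⟨hw, fun hh => hwK (hL w hh), hwS⟩
    have s1 := Finset.sum_le_sum hhigh
    have s2 := Finset.sum_le_sum hlow
    rw [Finset.sum_add_distrib] at s1 s2
    have s3 := h.sparse H ((Finset.card_le_card (Finset.filter_subset _ _)).trans (not_lt.1 hM))
    have s4 : ∑ u ∈ Lo, (H.filter fun w => G.Adj u w).card ≤ H.card := by
      rw [sum_card_adj_comm, Finset.card_eq_sum_ones]
      refine Finset.sum_le_sum fun w _ => le_trans (Finset.card_le_card ?_) (hone w)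
      intro u hu
      simp only [Finset.mem_filter, Finset.mem_univ, true_and, hLo] at hu ⊢
      exact ⟨hu.2, not_lt.1 hu.1.2⟩
    simp only [Finset.sum_const, smul_eq_mul] at s1 s2
    have hK := h.threshold
    rw [hsplit]
    rcases Nat.eq_zero_or_pos H.card with h0 | hpos
    · have hl : 2 ≤ Lo.card := by
        have hc : H.card + Lo.card = S.card := Finset.card_filter_add_card_filter_not _
        have hS1 : 0 < S.card := hS.card_pos
        by_contra hcon
        have : S.card = 1 := by omega
        obtain ⟨v, hv⟩ := Finset.card_eq_one.1 this
        have hvH : v ∈ H := Finset.mem_filter.2 ⟨by simp [hv], hsing v hv⟩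
        rw [Finset.card_eq_zero.1 h0] at hvH
        exact absurd hvH (Finset.notMem_empty v)
      nlinarith
    · nlinarith [Nat.mul_le_mul_left H.card hK, Nat.mul_le_mul_right (2 * d) hpos]

theorem Expands.mul_card_sub_one_le_labelCross {V : Type*} [Fintype V] {G : SimpleGraph V}
    {K C M d : ℕ} (h : Expands G K C M d) (c : V → V) :
    d * ((Finset.univ.image c).card - 1) ≤ labelCross G c := by
  set I := Finset.univ.image c with hI
  set L : Finset V := Finset.univ.filter fun v => G.degree v ≤ K ∧ ∀ w, c w = c v → w = v with hLdef
  have hLlow : ∀ v ∈ L, G.degree v ≤ K := fun v hv => (Finset.mem_filter.1 hv).2.1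
  have hLs : ∀ v ∈ L, ∀ w, c w = c v → w = v := fun v hv => (Finset.mem_filter.1 hv).2.2
  set J := I \ L.image c with hJ
  have hcardI : I.card = L.card + J.card := by
    have h1 : (L.image c).card = L.card :=
      Finset.card_image_of_injOn fun a _ b hb hab => hLs b hb a hab
    have h2 : L.image c ⊆ I := Finset.image_subset_image (Finset.subset_univ _)
    have : J.card + (L.image c).card = I.card := Finset.card_sdiff_add_card_eq_card h2
    omega
  have hmaps : ∀ u ∈ Lᶜ, c u ∈ J := by
    intro u hu
    rw [Finset.mem_compl] at hu
    refine Finset.mem_sdiff.2 ⟨Finset.mem_image_of_mem _ (Finset.mem_univ _), fun hcon => ?_⟩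
    obtain ⟨v, hv, hvu⟩ := Finset.mem_image.1 hcon
    exact hu (hLs v hv u hvu.symm ▸ hv)
  have htwo : 2 * labelCross G c =
      ∑ u, (Finset.univ.filter fun w => G.Adj u w ∧ c u ≠ c w).card := by
    refine Eq.trans ?_
      ((sum_card_adj_eq_two_mul G fun e => ∃ u ∈ e, ∃ w ∈ e, c u ≠ c w).symm.trans ?_)
    · unfold labelCross
      congr
    refine Finset.sum_congr rfl fun u _ => ?_
    congr 1
    ext w
    simp only [Finset.mem_filter, Finset.mem_univ, true_and, Sym2.mem_iff]
    refine and_congr_right fun _ => ⟨?_, fun hh => ⟨u, Or.inl rfl, w, Or.inr rfl, hh⟩⟩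
    rintro ⟨a, rfl | rfl, b, rfl | rfl, hab⟩
    · exact absurd rfl hab
    · exact hab
    · exact hab.symm
    · exact absurd rfl hab
  rw [← Finset.sum_add_sum_compl L] at htwo
  have hLsum : L.card * d ≤ ∑ u ∈ L, (Finset.univ.filter fun w => G.Adj u w ∧ c u ≠ c w).card := by
    rw [← smul_eq_mul, ← Finset.sum_const]
    refine Finset.sum_le_sum fun u hu => (h.le_degree u).trans ?_
    rw [degree_eq_card_filter]
    refine Finset.card_le_card fun w hw => ?_
    simp only [Finset.mem_filter, Finset.mem_univ, true_and] at hw ⊢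
    exact ⟨hw, fun hh => hw.ne (hLs u hu w hh.symm).symm⟩
  have hsplit : ∀ u ∈ Lᶜ, (L.filter fun w => G.Adj u w).card +
      (Finset.univ.filter fun w => G.Adj u w ∧ w ∉ L ∧ c u ≠ c w).card ≤
      (Finset.univ.filter fun w => G.Adj u w ∧ c u ≠ c w).card := by
    intro u hu
    rw [← Finset.card_union_of_disjoint]
    · refine Finset.card_le_card fun w hw => ?_
      simp only [Finset.mem_filter, Finset.mem_univ, true_and, Finset.mem_union] at hw ⊢
      rcases hw with hw | hw
      · exact ⟨hw.2, fun hh => hw.2.ne (hLs w hw.1 u hh)⟩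
      · exact ⟨hw.1, hw.2.2⟩
    · rw [Finset.disjoint_left]
      intro w hw hw'
      simp only [Finset.mem_filter, Finset.mem_univ, true_and] at hw hw'
      exact hw'.2.1 hw.1
  have hs := Finset.sum_le_sum hsplit
  rw [Finset.sum_add_distrib] at hs
  have hLsum' : L.card * d ≤ ∑ u ∈ Lᶜ, (L.filter fun w => G.Adj u w).card := by
    rw [sum_card_adj_comm, ← smul_eq_mul, ← Finset.sum_const]
    refine Finset.sum_le_sum fun u hu => (h.le_degree u).trans ?_
    rw [degree_eq_card_filter]
    refine Finset.card_le_card fun w hw => ?_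
    simp only [Finset.mem_filter, Finset.mem_univ, true_and, Finset.mem_compl] at hw ⊢
    exact ⟨fun hh => h.low_not_adj u w (hLlow u hu) (hLlow w hh) hw, hw⟩
  have hfib : 2 * d * (J.card - 1) ≤
      ∑ u ∈ Lᶜ, (Finset.univ.filter fun w => G.Adj u w ∧ w ∉ L ∧ c u ≠ c w).card := by
    rcases J.eq_empty_or_nonempty with hJ0 | hJne
    · simp [hJ0]
    let part : V → Finset V := fun i => Finset.univ.filter fun u => c u = i
    obtain ⟨i₀, hi₀, hmax⟩ := Finset.exists_max_image J (fun i => (part i).card) hJne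
    rw [← Finset.sum_fiberwise_of_maps_to hmaps, ← Finset.card_erase_of_mem hi₀]
    refine le_trans ?_ (Finset.sum_le_sum_of_subset (Finset.erase_subset i₀ J))
    rw [mul_comm, ← smul_eq_mul, ← Finset.sum_const]
    refine Finset.sum_le_sum fun i hi => ?_
    obtain ⟨hne, hiJ⟩ := Finset.mem_erase.1 hi
    obtain ⟨hiI, hiL⟩ := Finset.mem_sdiff.1 hiJ
    obtain ⟨v, -, hv⟩ := Finset.mem_image.1 hiI
    have hpart : (Lᶜ.filter fun u => c u = i) = part i := by
      ext u
      simp only [Finset.mem_filter, Finset.mem_compl, Finset.mem_univ, true_and, part,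
        and_iff_right_iff_imp]
      exact fun hu huL => hiL (Finset.mem_image.2 ⟨u, huL, hu⟩)
    rw [hpart]
    refine (h.two_mul_le_boundary (part i) L ⟨v, by simp [part, hv]⟩ ?_ hLlow ?_).trans ?_
    · have hdis : Disjoint (part i) (part i₀) := by
        rw [Finset.disjoint_left]
        intro u hu hu'
        simp only [part, Finset.mem_filter, Finset.mem_univ, true_and] at hu hu'
        exact hne (hu ▸ hu')
      have h1 := Finset.card_le_univ (part i ∪ part i₀)
      rw [Finset.card_union_of_disjoint hdis] at h1
      have := hmax i hiJ
      omega
    · intro x hx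
      by_contra hcon
      have hxi : c x = i := by
        have : x ∈ part i := by simp [hx]
        simpa [part] using this
      refine hiL (Finset.mem_image.2 ⟨x, Finset.mem_filter.2 ⟨Finset.mem_univ _, not_lt.1 hcon,
        fun w hw => ?_⟩, hxi⟩)
      have : w ∈ part i := by simp [part, hw, hxi]
      simpa [hx] using this
    · refine Finset.sum_le_sum fun u hu => Finset.card_le_card fun w hw => ?_
      simp only [Finset.mem_filter, Finset.mem_univ, true_and, part] at hu hw ⊢
      exact ⟨hw.1, hw.2.1, fun hh => hw.2.2 (hh ▸ hu)⟩
  have hfin : d * (I.card - 1) ≤ L.card * d + d * (J.card - 1) := by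
    rw [hcardI, mul_comm L.card, ← mul_add]
    exact Nat.mul_le_mul_left _ (by omega)
  have : 2 * d * (J.card - 1) = 2 * (d * (J.card - 1)) := by ring
  omega

theorem Expands.stp_eq_minDegree {V : Type*} [Fintype V] [Nontrivial V] {G : SimpleGraph V}
    {K C M : ℕ} (h : Expands G K C M G.minDegree) : stp G = G.minDegree :=
  _root_.stp_eq_minDegree (hasDisjSpanningTrees_of_labelCross G _ h.mul_card_sub_one_le_labelCross)
/-- Probability weight of a graph in `G(n,p)`. -/
noncomputable def grWeight (n : ℕ) (p : ℝ) (G : SimpleGraph (Fin n)) : ℝ :=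
  p ^ edgeCount G * (1 - p) ^ (n.choose 2 - edgeCount G)

/-- Expectation with respect to `G(n,p)`. -/
noncomputable def grExp (n : ℕ) (p : ℝ) (f : SimpleGraph (Fin n) → ℝ) : ℝ :=
  ∑ G, grWeight n p G * f G

/-- The set of potential edges. -/
noncomputable def allEdges (n : ℕ) : Finset (Sym2 (Fin n)) :=
  (⊤ : SimpleGraph (Fin n)).edgeFinset

theorem mem_allEdges {n : ℕ} {e : Sym2 (Fin n)} : e ∈ allEdges n ↔ ¬ e.IsDiag := by
  simp [allEdges]

theorem edgeFinset_subset_allEdges {n : ℕ} (G : SimpleGraph (Fin n)) :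
    G.edgeFinset ⊆ allEdges n := fun _ he =>
  mem_allEdges.2 (G.not_isDiag_of_mem_edgeSet (SimpleGraph.mem_edgeFinset.1 he))

theorem card_allEdges (n : ℕ) : (allEdges n).card = n.choose 2 := by
  have := SimpleGraph.card_edgeFinset_top_eq_card_choose_two (V := Fin n)
  rw [Fintype.card_fin] at this
  rw [← this, allEdges]

theorem grExp_prod (n : ℕ) (p : ℝ) (a b : Sym2 (Fin n) → ℝ) :
    grExp n p (fun G => ∏ e ∈ allEdges n, if e ∈ G.edgeFinset then a e else b e) =
      ∏ e ∈ allEdges n, (p * a e + (1 - p) * b e) := by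
  rw [Finset.prod_add, grExp]
  refine Finset.sum_bij' (fun G _ => G.edgeFinset) (fun t _ => SimpleGraph.fromEdgeSet (t : Set _))
    ?_ ?_ ?_ ?_ ?_
  · exact fun G _ => Finset.mem_powerset.2 (edgeFinset_subset_allEdges G)
  · simp
  · intro G _
    simp
  · intro t ht
    ext e
    have := Finset.mem_powerset.1 ht
    simp only [SimpleGraph.mem_edgeFinset, SimpleGraph.edgeSet_fromEdgeSet, Set.mem_sdiff,
      Finset.mem_coe]
    exact ⟨fun h => h.1, fun h => ⟨h, fun h' => mem_allEdges.1 (this h) h'⟩⟩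
  · intro G _
    have hsub := edgeFinset_subset_allEdges G
    rw [← Finset.prod_sdiff hsub, Finset.prod_mul_distrib, Finset.prod_mul_distrib,
      Finset.prod_const, Finset.prod_const, Finset.card_sdiff_of_subset hsub, card_allEdges,
      grWeight, edgeCount,
      Finset.prod_congr rfl fun e he => if_neg (Finset.mem_sdiff.1 he).2,
      Finset.prod_congr rfl fun e he => if_pos he]
    ring

theorem grExp_prod_edges (n : ℕ) (p : ℝ) (a : Sym2 (Fin n) → ℝ) :
    grExp n p (fun G => ∏ e ∈ G.edgeFinset, a e) =
      ∏ e ∈ allEdges n, (1 - p + p * a e) := by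
  have := grExp_prod n p a 1
  simp only [Pi.one_apply, mul_one] at this
  rw [Finset.prod_congr rfl fun e _ => add_comm (1 - p) (p * a e), ← this]
  congr 1
  ext G
  rw [← Finset.prod_filter, Finset.filter_mem_eq_inter,
    Finset.inter_eq_right.2 (edgeFinset_subset_allEdges G)]

theorem grWeight_nonneg {n : ℕ} {p : ℝ} (h0 : 0 ≤ p) (h1 : p ≤ 1) (G : SimpleGraph (Fin n)) :
    0 ≤ grWeight n p G :=
  mul_nonneg (pow_nonneg h0 _) (pow_nonneg (by linarith) _)

theorem grExp_one (n : ℕ) (p : ℝ) : grExp n p (fun _ => 1) = 1 := by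
  have := grExp_prod_edges n p 1
  simpa using this

theorem grExp_mono {n : ℕ} {p : ℝ} (h0 : 0 ≤ p) (h1 : p ≤ 1) {f g : SimpleGraph (Fin n) → ℝ}
    (h : ∀ G, f G ≤ g G) : grExp n p f ≤ grExp n p g :=
  Finset.sum_le_sum fun G _ => mul_le_mul_of_nonneg_left (h G) (grWeight_nonneg h0 h1 G)

theorem grExp_add (n : ℕ) (p : ℝ) (f g : SimpleGraph (Fin n) → ℝ) :
    grExp n p (fun G => f G + g G) = grExp n p f + grExp n p g := by
  simp only [grExp, mul_add, Finset.sum_add_distrib]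

theorem grExp_const_mul (n : ℕ) (p c : ℝ) (f : SimpleGraph (Fin n) → ℝ) :
    grExp n p (fun G => c * f G) = c * grExp n p f := by
  simp only [grExp, Finset.mul_sum]
  exact Finset.sum_congr rfl fun G _ => by ring

theorem grExp_sum {ι : Type*} (n : ℕ) (p : ℝ) (s : Finset ι)
    (f : ι → SimpleGraph (Fin n) → ℝ) :
    grExp n p (fun G => ∑ i ∈ s, f i G) = ∑ i ∈ s, grExp n p (f i) := by
  simp only [grExp, Finset.mul_sum]
  exact Finset.sum_comm

theorem grProb_eq_grExp (n : ℕ) (p : ℝ) (Q : SimpleGraph (Fin n) → Prop) :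
    grProb n p Q = grExp n p (fun G => if Q G then 1 else 0) := by
  simp [grProb, grExp, grWeight]

theorem grProb_nonneg {n : ℕ} {p : ℝ} (h0 : 0 ≤ p) (h1 : p ≤ 1)
    (Q : SimpleGraph (Fin n) → Prop) : 0 ≤ grProb n p Q := by
  rw [grProb_eq_grExp]
  refine Finset.sum_nonneg fun G _ => mul_nonneg (grWeight_nonneg h0 h1 G) ?_
  dsimp only
  split_ifs <;> norm_num

theorem grProb_le_grExp {n : ℕ} {p : ℝ} (h0 : 0 ≤ p) (h1 : p ≤ 1)
    {Q : SimpleGraph (Fin n) → Prop} {f : SimpleGraph (Fin n) → ℝ} (hf : ∀ G, 0 ≤ f G)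
    (hQ : ∀ G, Q G → 1 ≤ f G) : grProb n p Q ≤ grExp n p f := by
  rw [grProb_eq_grExp]
  refine grExp_mono h0 h1 fun G => ?_
  split_ifs with h
  · exact hQ G h
  · exact hf G

theorem grProb_mono {n : ℕ} {p : ℝ} (h0 : 0 ≤ p) (h1 : p ≤ 1)
    {Q R : SimpleGraph (Fin n) → Prop} (h : ∀ G, Q G → R G) : grProb n p Q ≤ grProb n p R := by
  rw [grProb_eq_grExp n p R]
  refine grProb_le_grExp h0 h1 (fun G => ?_) fun G hG => (if_pos (h G hG)).ge
  split_ifs <;> norm_num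

theorem grProb_le_sum {ι : Type*} {n : ℕ} {p : ℝ} (h0 : 0 ≤ p) (h1 : p ≤ 1) (s : Finset ι)
    {Q : SimpleGraph (Fin n) → Prop} {R : ι → SimpleGraph (Fin n) → Prop}
    (h : ∀ G, Q G → ∃ i ∈ s, R i G) : grProb n p Q ≤ ∑ i ∈ s, grProb n p (R i) := by
  simp only [grProb_eq_grExp n p (R _)]
  rw [← grExp_sum]
  have hnn : ∀ G, ∀ i ∈ s, (0 : ℝ) ≤ if R i G then 1 else 0 := fun G i _ => by
    split_ifs <;> norm_num
  refine grProb_le_grExp h0 h1 (fun G => Finset.sum_nonneg (hnn G)) fun G hG => ?_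
  obtain ⟨i, hi, hR⟩ := h G hG
  refine le_trans ?_ (Finset.single_le_sum (hnn G) hi)
  rw [if_pos hR]

theorem grProb_or_le {n : ℕ} {p : ℝ} (h0 : 0 ≤ p) (h1 : p ≤ 1)
    {Q R₁ R₂ : SimpleGraph (Fin n) → Prop} (h : ∀ G, Q G → R₁ G ∨ R₂ G) :
    grProb n p Q ≤ grProb n p R₁ + grProb n p R₂ := by
  have := grProb_le_sum h0 h1 (Q := Q) (Finset.univ : Finset Bool)
    (R := fun b => if b then R₁ else R₂) fun G hG => by simpa using (h G hG).symm
  simpa using this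

theorem grProb_add_not (n : ℕ) (p : ℝ) (Q : SimpleGraph (Fin n) → Prop) :
    grProb n p Q + grProb n p (fun G => ¬ Q G) = 1 := by
  rw [grProb_eq_grExp, grProb_eq_grExp, ← grExp_add]
  refine Eq.trans ?_ (grExp_one n p)
  congr 1
  ext G
  by_cases h : Q G <;> simp [h]

theorem grExp_pow_inter (n : ℕ) (p y : ℝ) {B : Finset (Sym2 (Fin n))} (hB : B ⊆ allEdges n) :
    grExp n p (fun G => y ^ (G.edgeFinset ∩ B).card) = (1 - p + p * y) ^ B.card := by
  have := grExp_prod_edges n p (fun e => if e ∈ B then y else 1)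
  have h2 : ∀ e, 1 - p + p * (if e ∈ B then y else 1) =
      if e ∈ B then 1 - p + p * y else 1 := fun e => by split_ifs <;> ring
  simp only [h2] at this
  rw [← Finset.prod_filter, Finset.filter_mem_eq_inter, Finset.inter_eq_right.2 hB,
    Finset.prod_const] at this
  rw [← this]
  congr 1
  ext G
  rw [← Finset.prod_filter, Finset.filter_mem_eq_inter, Finset.prod_const]

/-- Potential edges at a vertex. -/
noncomputable def edgeStar {n : ℕ} (u : Fin n) : Finset (Sym2 (Fin n)) :=
  (allEdges n).filter fun e => u ∈ e

theorem edgeStar_subset {n : ℕ} (u : Fin n) : edgeStar u ⊆ allEdges n :=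
  Finset.filter_subset _ _

theorem card_edgeStar {n : ℕ} (u : Fin n) : (edgeStar u).card = n - 1 := by
  have h := SimpleGraph.card_incidenceFinset_eq_degree (⊤ : SimpleGraph (Fin n)) u
  rw [SimpleGraph.degree, SimpleGraph.card_neighborFinset_eq_degree,
    SimpleGraph.complete_graph_degree, Fintype.card_fin] at h
  rw [← h]
  congr 1
  ext e
  simp only [edgeStar, Finset.mem_filter, SimpleGraph.mem_incidenceFinset,
    SimpleGraph.incidenceSet, Set.mem_ofPred_eq, mem_allEdges]
  simp

theorem degree_eq_card_inter_edgeStar {n : ℕ} (G : SimpleGraph (Fin n)) (u : Fin n) :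
    G.degree u = (G.edgeFinset ∩ edgeStar u).card := by
  rw [← SimpleGraph.card_incidenceFinset_eq_degree]
  congr 1
  ext e
  simp only [edgeStar, Finset.mem_filter, SimpleGraph.mem_incidenceFinset, Finset.mem_inter,
    SimpleGraph.incidenceSet, Set.mem_ofPred_eq, SimpleGraph.mem_edgeFinset]
  exact ⟨fun h => ⟨h.1, mem_allEdges.2 (G.not_isDiag_of_mem_edgeSet h.1), h.2⟩,
    fun h => ⟨h.1, h.2.2⟩⟩

theorem grExp_pow_degree (n : ℕ) (p x : ℝ) (u : Fin n) :
    grExp n p (fun G => x ^ G.degree u) = (1 - p + p * x) ^ (n - 1) := by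
  rw [← card_edgeStar u, ← grExp_pow_inter n p x (edgeStar_subset u)]
  congr 1
  ext G
  rw [degree_eq_card_inter_edgeStar]

/-- The weight which a potential edge contributes to `x ^ (deg u + deg v)`. -/
noncomputable def pairWeight {n : ℕ} (x : ℝ) (u v : Fin n) (e : Sym2 (Fin n)) : ℝ :=
  (if e ∈ edgeStar u then x else 1) * (if e ∈ edgeStar v then x else 1)

theorem pow_degree_mul_pow_degree {n : ℕ} (x : ℝ) (u v : Fin n) (G : SimpleGraph (Fin n)) :
    x ^ G.degree u * x ^ G.degree v = ∏ e ∈ G.edgeFinset, pairWeight x u v e := by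
  simp only [pairWeight]
  rw [Finset.prod_mul_distrib, ← Finset.prod_filter, ← Finset.prod_filter,
    Finset.filter_mem_eq_inter, Finset.filter_mem_eq_inter, Finset.prod_const, Finset.prod_const,
    degree_eq_card_inter_edgeStar, degree_eq_card_inter_edgeStar]

theorem prod_pairWeight {n : ℕ} (p x : ℝ) {u v : Fin n} (huv : u ≠ v) :
    ∏ e ∈ allEdges n, (1 - p + p * pairWeight x u v e) =
      (1 - p + p * x ^ 2) * ((1 - p + p * x) ^ (n - 2) * (1 - p + p * x) ^ (n - 2)) := by
  have hmem : s(u, v) ∈ allEdges n := mem_allEdges.2 (by simpa using huv)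
  have hu : s(u, v) ∈ edgeStar u := Finset.mem_filter.2 ⟨hmem, by simp⟩
  have hv : s(u, v) ∈ edgeStar v := Finset.mem_filter.2 ⟨hmem, by simp⟩
  rw [← Finset.mul_prod_erase _ _ hmem]
  congr 1
  · simp only [pairWeight, hu, hv, if_true]; ring
  · have hsplit : ∀ e ∈ (allEdges n).erase s(u, v), 1 - p + p * pairWeight x u v e =
        (if e ∈ edgeStar u then 1 - p + p * x else 1) * (if e ∈ edgeStar v then 1 - p + p * x else 1) := by
      intro e he
      have hne : ¬ (e ∈ edgeStar u ∧ e ∈ edgeStar v) := fun h => (Finset.mem_erase.1 he).1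
        ((Sym2.mem_and_mem_iff huv).1 ⟨(Finset.mem_filter.1 h.1).2, (Finset.mem_filter.1 h.2).2⟩)
      unfold pairWeight
      by_cases h1 : e ∈ edgeStar u
      · have h2 : e ∉ edgeStar v := fun h => hne ⟨h1, h⟩
        simp [h1, h2]
      · by_cases h2 : e ∈ edgeStar v <;> simp [h1, h2]
    have hcount : ∀ w, s(u, v) ∈ edgeStar w →
        ∏ e ∈ (allEdges n).erase s(u, v), (if e ∈ edgeStar w then 1 - p + p * x else 1) =
          (1 - p + p * x) ^ (n - 2) := by
      intro w hw
      rw [← Finset.prod_filter, Finset.prod_const, Finset.filter_mem_eq_inter,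
        Finset.erase_inter, Finset.inter_eq_right.2 (edgeStar_subset w),
        Finset.card_erase_of_mem hw, card_edgeStar]
      rfl
    rw [Finset.prod_congr rfl hsplit, Finset.prod_mul_distrib, hcount u hu, hcount v hv]

theorem grProb_card_inter_ge {n : ℕ} {p y : ℝ} (h0 : 0 ≤ p) (h1 : p ≤ 1) (hy : 1 ≤ y) (k : ℕ)
    {B : Finset (Sym2 (Fin n))} (hB : B ⊆ allEdges n) :
    grProb n p (fun G => k ≤ (G.edgeFinset ∩ B).card) ≤
      (y ^ k)⁻¹ * (1 - p + p * y) ^ B.card := by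
  have hy0 : 0 < y := by linarith
  rw [← grExp_pow_inter n p y hB, ← grExp_const_mul]
  refine grProb_le_grExp h0 h1 (fun G => by positivity) fun G hG => ?_
  rw [inv_mul_eq_div, one_le_div (by positivity)]
  exact pow_le_pow_right₀ hy hG

theorem grProb_card_inter_le {n : ℕ} {p y : ℝ} (h0 : 0 ≤ p) (h1 : p ≤ 1) (hy0 : 0 < y)
    (hy : y ≤ 1) (k : ℕ) {B : Finset (Sym2 (Fin n))} (hB : B ⊆ allEdges n) :
    grProb n p (fun G => (G.edgeFinset ∩ B).card ≤ k) ≤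
      (y ^ k)⁻¹ * (1 - p + p * y) ^ B.card := by
  rw [← grExp_pow_inter n p y hB, ← grExp_const_mul]
  refine grProb_le_grExp h0 h1 (fun G => by positivity) fun G hG => ?_
  rw [inv_mul_eq_div, one_le_div (by positivity)]
  exact pow_le_pow_of_le_one hy0.le hy hG

theorem sum_pow_card (n : ℕ) (r : ℝ) :
    ∑ T : Finset (Fin n), r ^ T.card = (1 + r) ^ n := by
  have := Finset.sum_pow_mul_eq_add_pow r 1 (Finset.univ : Finset (Fin n))
  simpa [add_comm] using this

theorem one_add_pow_le_exp {r : ℝ} (hr : 0 ≤ r) (n : ℕ) : (1 + r) ^ n ≤ Real.exp (n * r) := by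
  rw [Real.exp_nat_mul, add_comm]
  exact pow_le_pow_left₀ (by positivity) (Real.add_one_le_exp r) n

theorem grProb_dense_le {n : ℕ} {p y : ℝ} (h0 : 0 ≤ p) (h1 : p ≤ 1) (hy : 1 ≤ y) (C M : ℕ)
    (hM : p * y * M ≤ 1) :
    grProb n p (fun G => ∃ S : Finset (Fin n), S.card ≤ M ∧
      C * S.card < (G.edgeFinset.filter fun e => ∀ v ∈ e, v ∈ S).card) ≤
      Real.exp (n * (Real.exp 1 * (y ^ C)⁻¹)) - 1 := by
  have hy0 : 0 < y := by linarith
  set r : ℝ := Real.exp 1 * (y ^ C)⁻¹ with hr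
  have hr0 : 0 ≤ r := by positivity
  let B : Finset (Fin n) → Finset (Sym2 (Fin n)) := fun S =>
    (allEdges n).filter fun e => ∀ v ∈ e, v ∈ S
  have hinter : ∀ (G : SimpleGraph (Fin n)) S,
      (G.edgeFinset.filter fun e => ∀ v ∈ e, v ∈ S) = G.edgeFinset ∩ B S := fun G S => by
    ext e
    simp only [B, Finset.mem_filter, Finset.mem_inter]
    exact ⟨fun h => ⟨h.1, edgeFinset_subset_allEdges G h.1, h.2⟩, fun h => ⟨h.1, h.2.2⟩⟩
  have hcard : ∀ S, (B S).card ≤ S.card * S.card := fun S => by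
    rw [← Finset.card_product]
    refine (Finset.card_le_card ?_).trans (Finset.card_image_le (f := fun x => s(x.1, x.2)))
    intro e he
    induction e with
    | h u v =>
      have := (Finset.mem_filter.1 he).2
      exact Finset.mem_image.2 ⟨(u, v), Finset.mem_product.2
        ⟨this u (by simp), this v (by simp)⟩, rfl⟩
  have hsum : ∑ T ∈ (Finset.univ : Finset (Finset (Fin n))).erase ∅, r ^ T.card =
      (1 + r) ^ n - 1 := by
    rw [← sum_pow_card, ← Finset.add_sum_erase _ _ (Finset.mem_univ (∅ : Finset (Fin n)))]
    simp
  calc _ ≤ ∑ T ∈ (Finset.univ : Finset (Finset (Fin n))).erase ∅,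
        grProb n p (fun G => T.card ≤ M ∧ C * T.card < (G.edgeFinset ∩ B T).card) := by
        refine grProb_le_sum h0 h1 _ fun G ⟨S, hS, hlt⟩ => ⟨S, ?_, hS, hinter G S ▸ hlt⟩
        refine Finset.mem_erase.2 ⟨?_, Finset.mem_univ _⟩
        rintro rfl
        rw [hinter] at hlt
        exact absurd (hlt.trans_le ((Finset.card_le_card Finset.inter_subset_right).trans
          (hcard ∅))) (by simp)
    _ ≤ ∑ T ∈ (Finset.univ : Finset (Finset (Fin n))).erase ∅, r ^ T.card := by
        refine Finset.sum_le_sum fun T _ => ?_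
        by_cases hT : T.card ≤ M
        · calc _ ≤ grProb n p (fun G => C * T.card ≤ (G.edgeFinset ∩ B T).card) := by
                refine grProb_mono h0 h1 fun G hG => hG.2.le
            _ ≤ (y ^ (C * T.card))⁻¹ * (1 - p + p * y) ^ (B T).card :=
                grProb_card_inter_ge h0 h1 hy _ (Finset.filter_subset _ _)
            _ ≤ (y ^ (C * T.card))⁻¹ * Real.exp 1 ^ T.card := by
                gcongr
                calc (1 - p + p * y) ^ (B T).card ≤ (1 - p + p * y) ^ (T.card * T.card) :=
                      pow_le_pow_right₀ (by nlinarith) (hcard T)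
                  _ = ((1 - p + p * y) ^ T.card) ^ T.card := pow_mul _ _ _
                  _ ≤ ((1 + p * y) ^ T.card) ^ T.card := by
                      have : 0 ≤ p * y := by positivity
                      gcongr; linarith
                  _ ≤ Real.exp (T.card * (p * y)) ^ T.card := by
                      gcongr
                      exact one_add_pow_le_exp (by positivity) _
                  _ ≤ Real.exp 1 ^ T.card := by
                      gcongr
                      refine le_trans ?_ hM
                      rw [mul_comm]
                      gcongr
            _ = r ^ T.card := by rw [hr, mul_pow, inv_pow, ← pow_mul, mul_comm]
        · simp only [hT, false_and]
          rw [show grProb n p (fun _ => False) = 0 by simp [grProb]]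
          positivity
    _ ≤ _ := by
        rw [hsum]
        have := one_add_pow_le_exp hr0 n
        linarith

/-- Potential edges between `S` and its complement. -/
noncomputable def edgeCut {n : ℕ} (S : Finset (Fin n)) : Finset (Sym2 (Fin n)) :=
  (S ×ˢ Sᶜ).image fun x => s(x.1, x.2)

theorem injOn_edgeCut {n : ℕ} (S : Finset (Fin n)) :
    Set.InjOn (fun x : Fin n × Fin n => s(x.1, x.2)) (S ×ˢ Sᶜ : Finset (Fin n × Fin n)) := by
  rintro ⟨a, b⟩ hab ⟨c, d⟩ hcd h
  simp only [Finset.coe_product, Set.mem_prod, Finset.mem_coe, Finset.mem_compl] at hab hcd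
  rcases Sym2.eq_iff.1 h with h | h
  · exact Prod.ext h.1 h.2
  · exact absurd ((show a = d from h.1) ▸ hab.1) hcd.2

theorem edgeCut_subset {n : ℕ} (S : Finset (Fin n)) : edgeCut S ⊆ allEdges n := by
  intro e he
  obtain ⟨x, hx, rfl⟩ := Finset.mem_image.1 he
  rw [Finset.mem_product, Finset.mem_compl] at hx
  exact mem_allEdges.2 fun h => hx.2 (Sym2.mk_isDiag_iff.1 h ▸ hx.1)

theorem card_edgeCut {n : ℕ} (S : Finset (Fin n)) :
    (edgeCut S).card = S.card * (n - S.card) := by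
  rw [edgeCut, Finset.card_image_of_injOn (injOn_edgeCut S), Finset.card_product,
    Finset.card_compl, Fintype.card_fin]

theorem crossCount_eq_card_inter {n : ℕ} (G : SimpleGraph (Fin n)) (S : Finset (Fin n)) :
    crossCount G S = (G.edgeFinset ∩ edgeCut S).card := by
  refine (Finset.card_image_of_injOn (f := fun x : Fin n × Fin n => s(x.1, x.2))
    ((injOn_edgeCut S).mono ?_)).symm.trans ?_
  · intro x hx
    simpa using (Finset.mem_filter.1 hx).1
  congr 1
  ext e
  simp only [edgeCut, Finset.mem_image, Finset.mem_filter, Finset.mem_inter, Finset.mem_product,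
    Finset.mem_compl]
  constructor
  · rintro ⟨x, ⟨hx, hadj⟩, rfl⟩
    exact ⟨SimpleGraph.mem_edgeFinset.2 hadj, x, hx, rfl⟩
  · rintro ⟨hG, x, hx, rfl⟩
    exact ⟨x, ⟨hx, SimpleGraph.mem_edgeFinset.1 hG⟩, rfl⟩

theorem grProb_small_cut_le {n : ℕ} {p : ℝ} (h0 : 0 ≤ p) (h1 : p ≤ 1) (M : ℕ) :
    grProb n p (fun G => ∃ S : Finset (Fin n), M < S.card ∧ 2 * S.card ≤ n ∧
      crossCount G S < 2 * S.card) ≤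
      Real.exp (n * (Real.exp 1 * (4 * Real.exp (-(n * p / 4)))) - M) := by
  set r : ℝ := 4 * Real.exp (-(n * p / 4)) with hr
  have hr0 : 0 ≤ r := by positivity
  calc _ ≤ ∑ T : Finset (Fin n), grProb n p (fun G => (M < T.card ∧ 2 * T.card ≤ n) ∧
        (G.edgeFinset ∩ edgeCut T).card ≤ 2 * T.card) :=
        grProb_le_sum h0 h1 _ fun G ⟨S, hM, hn, hlt⟩ => ⟨S, Finset.mem_univ _, ⟨hM, hn⟩,
          crossCount_eq_card_inter G S ▸ hlt.le⟩
    _ ≤ ∑ T : Finset (Fin n), Real.exp (-M) * (Real.exp 1 * r) ^ T.card := by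
        refine Finset.sum_le_sum fun T _ => ?_
        by_cases hT : M < T.card ∧ 2 * T.card ≤ n
        · have hcut : (n : ℝ) * T.card ≤ 2 * (edgeCut T).card := by
            rw [card_edgeCut]
            have : n * T.card ≤ 2 * (T.card * (n - T.card)) := by
              obtain ⟨k, hk⟩ := Nat.exists_eq_add_of_le hT.2
              have : n - T.card = T.card + k := by omega
              rw [this]
              nlinarith
            exact_mod_cast this
          calc _ ≤ grProb n p (fun G => (G.edgeFinset ∩ edgeCut T).card ≤ 2 * T.card) :=
                grProb_mono h0 h1 fun G hG => hG.2
            _ ≤ (((1 / 2 : ℝ)) ^ (2 * T.card))⁻¹ * (1 - p + p * (1 / 2)) ^ (edgeCut T).card :=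
                grProb_card_inter_le h0 h1 (by norm_num) (by norm_num) _ (edgeCut_subset T)
            _ ≤ 4 ^ T.card * Real.exp (-(p / 2)) ^ (edgeCut T).card := by
                have hq : 1 - p + p * (1 / 2) ≤ Real.exp (-(p / 2)) := by
                  have := Real.add_one_le_exp (-(p / 2))
                  linarith
                rw [pow_mul, ← inv_pow]
                have : 0 ≤ 1 - p + p * (1 / 2) := by linarith
                gcongr
                norm_num
            _ ≤ 4 ^ T.card * Real.exp (-(n * p / 4)) ^ T.card := by
                rw [← Real.exp_nat_mul, ← Real.exp_nat_mul]
                refine mul_le_mul_of_nonneg_left (Real.exp_le_exp.2 ?_) (by positivity)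
                nlinarith
            _ = r ^ T.card := by rw [hr, mul_pow]
            _ ≤ Real.exp (T.card - M) * r ^ T.card := by
                refine le_mul_of_one_le_left (by positivity) (Real.one_le_exp ?_)
                have : (M : ℝ) ≤ T.card := by exact_mod_cast hT.1.le
                linarith
            _ = Real.exp (-M) * (Real.exp 1 * r) ^ T.card := by
                rw [mul_pow _ r, ← Real.exp_nat_mul, mul_one, ← mul_assoc, ← Real.exp_add]
                ring_nf
        · simp only [hT, false_and]
          rw [show grProb n p (fun _ => False) = 0 by simp [grProb]]
          positivity
    _ = Real.exp (-M) * (1 + Real.exp 1 * r) ^ n := by rw [← Finset.mul_sum, sum_pow_card]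
    _ ≤ Real.exp (-M) * Real.exp (n * (Real.exp 1 * r)) := by
        gcongr
        exact one_add_pow_le_exp (by positivity) _
    _ = _ := by rw [← Real.exp_add]; ring_nf

theorem grProb_all_degree_gt_le {n : ℕ} {p x y : ℝ} (h0 : 0 ≤ p) (h1 : p < 1) (hx : 0 < x)
    (hxy : x ≤ y) (hn : 2 ≤ n) (a : ℕ) :
    grProb n p (fun G => ∀ u, a < G.degree u) ≤
      4 * (((1 - p + p * x ^ 2) / (1 - p + p * x) ^ 2) ^ (n - 1) / n +
        ((1 - p + p * x ^ 2) / (1 - p + p * x) ^ 2 - 1)) +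
      2 * ((x / y) ^ a * ((1 - p + p * y) / (1 - p + p * x)) ^ (n - 1)) := by
  have hy : 0 < y := hx.trans_le hxy
  have hm : 0 < 1 - p + p * x := by nlinarith
  have hm2 : 0 < 1 - p + p * x ^ 2 := by nlinarith [mul_nonneg h0 (sq_nonneg x)]
  have hn0 : (0 : ℝ) < n := by exact_mod_cast (by omega : 0 < n)
  set m := 1 - p + p * x with hmdef
  set m₂ := 1 - p + p * x ^ 2 with hm₂def
  set μ : ℝ := n * m ^ (n - 1) with hμ
  have hμ0 : 0 < μ := by positivity
  let X : SimpleGraph (Fin n) → ℝ := fun G => ∑ u, x ^ G.degree u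
  let Y : SimpleGraph (Fin n) → ℝ := fun G => ∑ u, y ^ G.degree u
  have hEX : grExp n p X = μ := by
    simp only [X]
    rw [grExp_sum]
    simp [grExp_pow_degree, hμ, hmdef]
  have hEY : grExp n p Y = n * (1 - p + p * y) ^ (n - 1) := by
    simp only [Y]
    rw [grExp_sum]
    simp [grExp_pow_degree]
  have hEX2 : grExp n p (fun G => X G * X G) =
      n * m₂ ^ (n - 1) + n * (n - 1) * (m₂ * (m ^ (n - 2) * m ^ (n - 2))) := by
    have hpair : ∀ u v : Fin n, grExp n p (fun G => x ^ G.degree u * x ^ G.degree v) =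
        if v = u then m₂ ^ (n - 1) else m₂ * (m ^ (n - 2) * m ^ (n - 2)) := by
      intro u v
      split_ifs with huv
      · subst huv
        simp only [← mul_pow, grExp_pow_degree, hm₂def, sq]
      · simp only [pow_degree_mul_pow_degree, grExp_prod_edges]
        exact prod_pairWeight p x (Ne.symm huv)
    simp only [X, Finset.sum_mul_sum]
    rw [grExp_sum]
    simp only [grExp_sum, hpair]
    have hrow : ∀ u : Fin n, (∑ v : Fin n, if v = u then m₂ ^ (n - 1) else
        m₂ * (m ^ (n - 2) * m ^ (n - 2))) =
        m₂ ^ (n - 1) + (n - 1) * (m₂ * (m ^ (n - 2) * m ^ (n - 2))) := by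
      intro u
      rw [← Finset.add_sum_erase _ _ (Finset.mem_univ u), if_pos rfl,
        Finset.sum_congr rfl fun v hv => if_neg (Finset.ne_of_mem_erase hv), Finset.sum_const,
        Finset.card_erase_of_mem (Finset.mem_univ u), Finset.card_univ, Fintype.card_fin,
        nsmul_eq_mul, Nat.cast_sub (by omega), Nat.cast_one]
    rw [Finset.sum_congr rfl fun u _ => hrow u, Finset.sum_const, Finset.card_univ,
      Fintype.card_fin, nsmul_eq_mul]
    ring
  have hbound : grProb n p (fun G => ∀ u, a < G.degree u) ≤
      grExp n p (fun G => 4 / μ ^ 2 * (X G * X G) + (-(8 / μ)) * X G + 4 * 1 +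
        2 * (x / y) ^ a / μ * Y G) := by
    have hsq : ∀ G, 4 / μ ^ 2 * (X G * X G) + (-(8 / μ)) * X G + 4 * 1 =
        4 * (X G / μ - 1) ^ 2 := fun G => by field_simp; ring
    have hY : ∀ G, 0 ≤ Y G := fun G => Finset.sum_nonneg fun u _ => by positivity
    simp only [hsq]
    refine grProb_le_grExp h0 h1.le (fun G => ?_) fun G hG => ?_
    · have := hY G
      positivity
    · have hXY : X G ≤ (x / y) ^ a * Y G := by
        simp only [X, Y, Finset.mul_sum]
        refine Finset.sum_le_sum fun u _ => ?_
        calc x ^ G.degree u = (x / y) ^ G.degree u * y ^ G.degree u := by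
              rw [← mul_pow, div_mul_cancel₀ _ hy.ne']
          _ ≤ _ := by
              gcongr ?_ * _
              exact pow_le_pow_of_le_one (by positivity) ((div_le_one hy).2 hxy) (hG u).le
      have hrew : 2 * (x / y) ^ a / μ * Y G = 2 * (((x / y) ^ a * Y G) / μ) := by ring
      rw [hrew]
      have hle : X G / μ ≤ (x / y) ^ a * Y G / μ := by gcongr
      by_cases hh : X G / μ ≤ 1 / 2
      · have : 0 ≤ (x / y) ^ a * Y G / μ := by have := hY G; positivity
        nlinarith
      · nlinarith [sq_nonneg (X G / μ - 1)]
  refine hbound.trans ?_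
  rw [grExp_add, grExp_add, grExp_add, grExp_const_mul, grExp_const_mul, grExp_const_mul,
    grExp_const_mul, grExp_one, hEX, hEX2, hEY]
  obtain ⟨k, rfl⟩ := Nat.exists_eq_add_of_le hn
  have e1 : 2 + k - 1 = k + 1 := by omega
  have e2 : 2 + k - 2 = k := by omega
  rw [e1] at hμ
  simp only [e1, e2]
  have hT1 : 4 / μ ^ 2 * ((2 + k : ℕ) * m₂ ^ (k + 1)) =
      4 * ((m₂ / m ^ 2) ^ (k + 1) / (2 + k : ℕ)) := by
    rw [hμ, div_pow, ← pow_mul]; field_simp; ring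
  have hT2 : 4 / μ ^ 2 * ((2 + k : ℕ) * ((2 + k : ℕ) - 1) * (m₂ * (m ^ k * m ^ k))) ≤
      4 * (m₂ / m ^ 2) := by
    rw [hμ]
    have : 4 / ((2 + k : ℕ) * m ^ (k + 1)) ^ 2 *
        ((2 + k : ℕ) * ((2 + k : ℕ) - 1) * (m₂ * (m ^ k * m ^ k))) =
        4 * (m₂ / m ^ 2) * (((2 + k : ℕ) - 1) / (2 + k : ℕ)) := by
      field_simp; ring
    rw [this]
    refine mul_le_of_le_one_right (by positivity) ?_
    rw [div_le_one hn0]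
    linarith
  have hT3 : 2 * (x / y) ^ a / μ * ((2 + k : ℕ) * (1 - p + p * y) ^ (k + 1)) =
      2 * ((x / y) ^ a * ((1 - p + p * y) / m) ^ (k + 1)) := by
    rw [hμ, div_pow _ m]; field_simp
  have hT4 : -(8 / μ) * μ = -8 := by field_simp
  rw [mul_add, hT1, hT3, hT4]
  linarith

theorem grExp_subset_pow_degree_le {n : ℕ} {p x : ℝ} (h0 : 0 ≤ p) (hp : p ≤ 1 / 2)
    (hx0 : 0 ≤ x) (hx1 : x ≤ 1) {u v : Fin n} (huv : u ≠ v) {R : Finset (Sym2 (Fin n))}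
    (hR : R ⊆ allEdges n) :
    grExp n p (fun G => (if R ⊆ G.edgeFinset then 1 else 0) *
      (x ^ G.degree u * x ^ G.degree v)) ≤
      (2 * p) ^ R.card * ((1 - p + p * x) ^ (n - 2) * (1 - p + p * x) ^ (n - 2)) := by
  have hw0 : ∀ e, 0 ≤ pairWeight x u v e := fun e => by
    unfold pairWeight
    split_ifs <;> positivity
  have hw1 : ∀ e, pairWeight x u v e ≤ 1 := fun e => by
    unfold pairWeight
    split_ifs <;> nlinarith
  have hrew : ∀ G : SimpleGraph (Fin n), (if R ⊆ G.edgeFinset then (1 : ℝ) else 0) *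
      (x ^ G.degree u * x ^ G.degree v) = ∏ e ∈ allEdges n,
        if e ∈ G.edgeFinset then pairWeight x u v e else (if e ∈ R then 0 else 1) := by
    intro G
    split_ifs with h
    · rw [one_mul, pow_degree_mul_pow_degree,
        ← Finset.inter_eq_right.2 (edgeFinset_subset_allEdges G), ← Finset.filter_mem_eq_inter,
        Finset.prod_filter]
      refine Finset.prod_congr rfl fun e _ => ?_
      rw [Finset.filter_mem_eq_inter, Finset.inter_eq_right.2 (edgeFinset_subset_allEdges G)]
      by_cases he : e ∈ G.edgeFinset
      · rw [if_pos he, if_pos he]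
      · rw [if_neg he, if_neg he, if_neg fun h' => he (h h')]
    · obtain ⟨e, heR, heG⟩ := Finset.not_subset.1 h
      rw [zero_mul, Finset.prod_eq_zero (hR heR)]
      rw [if_neg heG, if_pos heR]
  simp only [hrew]
  rw [grExp_prod]
  have hpx : p * x ^ 2 ≤ p := mul_le_of_le_one_right h0 (pow_le_one₀ hx0 hx1)
  have hpx0 : 0 ≤ p * x := by positivity
  calc _ ≤ ∏ e ∈ allEdges n, (if e ∈ R then 2 * p else 1) *
        (1 - p + p * pairWeight x u v e) := by
        refine Finset.prod_le_prod (fun e _ => ?_) fun e _ => ?_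
        · have := mul_nonneg h0 (hw0 e)
          split_ifs <;> linarith
        · have := mul_nonneg h0 (hw0 e)
          have := mul_nonneg h0 this
          have := mul_le_mul_of_nonneg_left (hw1 e) h0
          split_ifs
          · nlinarith
          · linarith
    _ = (2 * p) ^ R.card * ((1 - p + p * x ^ 2) *
          ((1 - p + p * x) ^ (n - 2) * (1 - p + p * x) ^ (n - 2))) := by
        rw [Finset.prod_mul_distrib, prod_pairWeight p x huv, ← Finset.prod_filter,
          Finset.filter_mem_eq_inter, Finset.inter_eq_right.2 hR, Finset.prod_const]
    _ ≤ _ := by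
        refine mul_le_mul_of_nonneg_left (mul_le_of_le_one_left ?_ (by linarith)) (by positivity)
        have : 0 ≤ 1 - p + p * x := by linarith
        positivity

theorem grProb_subset_low_le {n : ℕ} {p x : ℝ} (h0 : 0 ≤ p) (hp : p ≤ 1 / 2)
    (hx0 : 0 < x) (hx1 : x ≤ 1) {u v : Fin n} (huv : u ≠ v) (R : Finset (Sym2 (Fin n)))
    (K : ℕ) :
    grProb n p (fun G => R ⊆ G.edgeFinset ∧ G.degree u ≤ K ∧ G.degree v ≤ K) ≤
      (2 * p) ^ R.card * ((x ^ K)⁻¹ * (1 - p + p * x) ^ (n - 2)) ^ 2 := by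
  by_cases hR : R ⊆ allEdges n
  · calc _ ≤ grExp n p (fun G => (x ^ K * x ^ K)⁻¹ * ((if R ⊆ G.edgeFinset then 1 else 0) *
          (x ^ G.degree u * x ^ G.degree v))) := by
          refine grProb_le_grExp h0 (by linarith) (fun G => ?_) fun G hG => ?_
          · split_ifs <;> positivity
          · rw [if_pos hG.1, one_mul, inv_mul_eq_div, one_le_div (by positivity)]
            exact mul_le_mul (pow_le_pow_of_le_one hx0.le hx1 hG.2.1)
              (pow_le_pow_of_le_one hx0.le hx1 hG.2.2) (by positivity) (by positivity)
      _ ≤ (x ^ K * x ^ K)⁻¹ * ((2 * p) ^ R.card *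
          ((1 - p + p * x) ^ (n - 2) * (1 - p + p * x) ^ (n - 2))) := by
          rw [grExp_const_mul]
          exact mul_le_mul_of_nonneg_left
            (grExp_subset_pow_degree_le h0 hp hx0.le hx1 huv hR) (by positivity)
      _ = _ := by rw [mul_inv]; ring
  · have : grProb n p (fun G => R ⊆ G.edgeFinset ∧ G.degree u ≤ K ∧ G.degree v ≤ K) ≤
        grProb n p fun _ => False :=
      grProb_mono h0 (by linarith) fun G hG => hR (hG.1.trans (edgeFinset_subset_allEdges G))
    refine this.trans ?_
    rw [show grProb n p (fun _ => False) = 0 by simp [grProb]]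
    positivity

theorem grProb_low_adj_le {n : ℕ} {p x : ℝ} (h0 : 0 ≤ p) (hp : p ≤ 1 / 2)
    (hx0 : 0 < x) (hx1 : x ≤ 1) (K : ℕ) :
    grProb n p (fun G => ∃ u v, G.degree u ≤ K ∧ G.degree v ≤ K ∧ G.Adj u v) ≤
      n ^ 2 * (2 * p) * ((x ^ K)⁻¹ * (1 - p + p * x) ^ (n - 2)) ^ 2 := by
  set c := ((x ^ K)⁻¹ * (1 - p + p * x) ^ (n - 2)) ^ 2 with hc
  calc _ ≤ ∑ i ∈ (Finset.univ : Finset (Fin n)).offDiag,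
        grProb n p (fun G => {s(i.1, i.2)} ⊆ G.edgeFinset ∧ G.degree i.1 ≤ K ∧
          G.degree i.2 ≤ K) := by
        refine grProb_le_sum h0 (by linarith) _ fun G ⟨u, v, hu, hv, h⟩ => ⟨(u, v), ?_, ?_, hu, hv⟩
        · simpa using h.ne
        · simpa using h
    _ ≤ ∑ i ∈ (Finset.univ : Finset (Fin n)).offDiag, 2 * p * c := by
        refine Finset.sum_le_sum fun i hi => ?_
        have := grProb_subset_low_le h0 hp hx0 hx1 (Finset.mem_offDiag.1 hi).2.2 {s(i.1, i.2)} K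
        simpa [hc] using this
    _ ≤ ∑ i : Fin n × Fin n, 2 * p * c :=
        Finset.sum_le_sum_of_subset_of_nonneg (Finset.subset_univ _) fun _ _ _ => by positivity
    _ = _ := by
        simp
        ring

theorem grProb_low_common_le {n : ℕ} {p x : ℝ} (h0 : 0 ≤ p) (hp : p ≤ 1 / 2)
    (hx0 : 0 < x) (hx1 : x ≤ 1) (K : ℕ) :
    grProb n p (fun G => ∃ w u v, G.degree u ≤ K ∧ G.degree v ≤ K ∧ u ≠ v ∧
      G.Adj w u ∧ G.Adj w v) ≤
      n ^ 3 * (2 * p) ^ 2 * ((x ^ K)⁻¹ * (1 - p + p * x) ^ (n - 2)) ^ 2 := by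
  set c := ((x ^ K)⁻¹ * (1 - p + p * x) ^ (n - 2)) ^ 2 with hc
  calc _ ≤ ∑ i ∈ (Finset.univ : Finset (Fin n)) ×ˢ (Finset.univ : Finset (Fin n)).offDiag,
        grProb n p (fun G => {s(i.1, i.2.1), s(i.1, i.2.2)} ⊆ G.edgeFinset ∧
          G.degree i.2.1 ≤ K ∧ G.degree i.2.2 ≤ K) := by
        refine grProb_le_sum h0 (by linarith) _ fun G ⟨w, u, v, hu, hv, huv, hwu, hwv⟩ =>
          ⟨(w, u, v), ?_, ?_, hu, hv⟩
        · simpa using huv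
        · simp [Finset.insert_subset_iff, hwu, hwv]
    _ ≤ ∑ i ∈ (Finset.univ : Finset (Fin n)) ×ˢ (Finset.univ : Finset (Fin n)).offDiag,
        (2 * p) ^ 2 * c := by
        refine Finset.sum_le_sum fun i hi => ?_
        have hne := (Finset.mem_offDiag.1 (Finset.mem_product.1 hi).2).2.2
        have := grProb_subset_low_le h0 hp hx0 hx1 hne {s(i.1, i.2.1), s(i.1, i.2.2)} K
        rwa [Finset.card_pair fun h => hne (Sym2.congr_right.1 h)] at this
    _ ≤ ∑ i : Fin n × Fin n × Fin n, (2 * p) ^ 2 * c :=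
        Finset.sum_le_sum_of_subset_of_nonneg (Finset.subset_univ _) fun _ _ _ => by positivity
    _ = _ := by
        simp
        ring

theorem tendsto_log_natCast : Tendsto (fun n : ℕ => Real.log n) atTop atTop :=
  Real.tendsto_log_atTop.comp tendsto_natCast_atTop_atTop

theorem tendsto_natCast_rpow_neg {s : ℝ} (hs : 0 < s) :
    Tendsto (fun n : ℕ => (n : ℝ) ^ (-s)) atTop (nhds 0) :=
  (tendsto_rpow_neg_atTop hs).comp tendsto_natCast_atTop_atTop

theorem tendsto_natCast_rpow {s : ℝ} (hs : 0 < s) :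
    Tendsto (fun n : ℕ => (n : ℝ) ^ s) atTop atTop :=
  (tendsto_rpow_atTop hs).comp tendsto_natCast_atTop_atTop

theorem tendsto_log_mul_rpow_neg {s : ℝ} (hs : 0 < s) :
    Tendsto (fun n : ℕ => Real.log n * (n : ℝ) ^ (-s)) atTop (nhds 0) := by
  have := ((isLittleO_log_rpow_atTop hs).tendsto_div_nhds_zero).comp tendsto_natCast_atTop_atTop
  refine this.congr fun n => ?_
  simp only [Function.comp_apply]
  rw [Real.rpow_neg (Nat.cast_nonneg n), div_eq_mul_inv]

theorem tendsto_exp_sub_mul_log {c s : ℝ} (hs : 0 < s) :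
    Tendsto (fun n : ℕ => Real.exp (c - s * Real.log n)) atTop (nhds 0) :=
  Real.tendsto_exp_atBot.comp
    (tendsto_const_nhds.add_atBot (tendsto_neg_atTop_atBot.comp
      (tendsto_log_natCast.const_mul_atTop hs)))

section Asymptotics

variable {p : ℕ → ℝ}

theorem tendsto_zero_of_le_log (hp0 : ∀ n, 0 ≤ p n)
    (hhigh : ∀ᶠ n : ℕ in atTop, n * p n ≤ 1.1 * Real.log n) : Tendsto p atTop (nhds 0) := by
  have h := (tendsto_log_mul_rpow_neg one_pos).const_mul 1.1
  rw [mul_zero] at h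
  refine squeeze_zero' (Eventually.of_forall hp0) ?_ h
  filter_upwards [hhigh, eventually_gt_atTop 0] with n hn hn0
  have : (0 : ℝ) < n := by exact_mod_cast hn0
  rw [Real.rpow_neg_one, ← mul_assoc, ← div_eq_mul_inv, le_div_iff₀ this]
  linarith

theorem tendsto_grProb_dense (hp0 : ∀ n, 0 ≤ p n) (hp1 : ∀ n, p n ≤ 1)
    (hhigh : ∀ᶠ n : ℕ in atTop, n * p n ≤ 1.1 * Real.log n) :
    Tendsto (fun n : ℕ => grProb n (p n) fun G => ∃ S : Finset (Fin n),
      S.card ≤ ⌊(n : ℝ) ^ (0.9 : ℝ)⌋₊ ∧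
      21 * S.card < (G.edgeFinset.filter fun e => ∀ v ∈ e, v ∈ S).card) atTop (nhds 0) := by
  have hlim : Tendsto (fun n : ℕ => Real.exp (Real.exp 1 * (n : ℝ) ^ (-0.05 : ℝ)) - 1)
      atTop (nhds 0) := by
    have h := (tendsto_natCast_rpow_neg (by norm_num : (0 : ℝ) < 0.05)).const_mul (Real.exp 1)
    rw [mul_zero] at h
    have := ((Real.continuous_exp.tendsto 0).comp h).sub_const 1
    simpa using this
  refine squeeze_zero' (Eventually.of_forall fun n => grProb_nonneg (hp0 n) (hp1 n) _) ?_ hlim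
  have hsmall := (tendsto_log_mul_rpow_neg (by norm_num : (0 : ℝ) < 0.05)).eventually
    (eventually_le_nhds (by norm_num : (0 : ℝ) < 0.5))
  filter_upwards [hhigh, eventually_gt_atTop 0, hsmall] with n hn hn0 hs
  have hnpos : (0 : ℝ) < n := by exact_mod_cast hn0
  have hn1 : (1 : ℝ) ≤ n := by exact_mod_cast hn0
  have hM : p n * (n : ℝ) ^ (0.05 : ℝ) * (⌊(n : ℝ) ^ (0.9 : ℝ)⌋₊ : ℕ) ≤ 1 := by
    calc _ ≤ p n * (n : ℝ) ^ (0.05 : ℝ) * (n : ℝ) ^ (0.9 : ℝ) := by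
          have := hp0 n
          gcongr
          exact Nat.floor_le (by positivity)
      _ = n * p n * (n : ℝ) ^ (-0.05 : ℝ) := by
          rw [mul_assoc, ← Real.rpow_add hnpos, mul_comm (n : ℝ), mul_assoc,
            ← Real.rpow_one_add' hnpos.le (by norm_num)]
          norm_num
      _ ≤ 1.1 * Real.log n * (n : ℝ) ^ (-0.05 : ℝ) := by gcongr
      _ ≤ 1 := by linarith
  refine (grProb_dense_le (hp0 n) (hp1 n) (Real.one_le_rpow hn1 (by norm_num)) 21 _ hM).trans
    (le_of_eq ?_)
  congr 2
  rw [← Real.rpow_natCast, ← Real.rpow_mul hnpos.le, ← Real.rpow_neg hnpos.le, mul_left_comm,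
    ← Real.rpow_one_add' hnpos.le (by norm_num)]
  norm_num

theorem tendsto_grProb_small_cut (hp0 : ∀ n, 0 ≤ p n) (hp1 : ∀ n, p n ≤ 1)
    (hlow : ∀ᶠ n : ℕ in atTop, Real.log n ≤ n * p n) :
    Tendsto (fun n : ℕ => grProb n (p n) fun G => ∃ S : Finset (Fin n),
      ⌊(n : ℝ) ^ (0.9 : ℝ)⌋₊ < S.card ∧ 2 * S.card ≤ n ∧ crossCount G S < 2 * S.card)
      atTop (nhds 0) := by
  have hlim : Tendsto (fun n : ℕ => Real.exp (1 + (n : ℝ) ^ (0.75 : ℝ) *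
      (4 * Real.exp 1 + -(n : ℝ) ^ (0.15 : ℝ)))) atTop (nhds 0) :=
    Real.tendsto_exp_atBot.comp (tendsto_const_nhds.add_atBot
      ((tendsto_natCast_rpow (by norm_num)).atTop_mul_atBot₀
        (tendsto_const_nhds.add_atBot (tendsto_neg_atTop_atBot.comp
          (tendsto_natCast_rpow (by norm_num))))))
  refine squeeze_zero' (Eventually.of_forall fun n => grProb_nonneg (hp0 n) (hp1 n) _) ?_ hlim
  filter_upwards [hlow, eventually_gt_atTop 0] with n hn hn0
  have hnpos : (0 : ℝ) < n := by exact_mod_cast hn0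
  refine (grProb_small_cut_le (hp0 n) (hp1 n) _).trans (Real.exp_le_exp.2 ?_)
  have hfloor := (Nat.lt_floor_add_one ((n : ℝ) ^ (0.9 : ℝ))).le
  have h1 : (n : ℝ) * Real.exp (-(n * p n / 4)) ≤ (n : ℝ) ^ (0.75 : ℝ) := by
    calc (n : ℝ) * Real.exp (-(n * p n / 4)) ≤ n * Real.exp (-(Real.log n / 4)) := by gcongr
      _ = Real.exp (Real.log n) * Real.exp (-(Real.log n / 4)) := by rw [Real.exp_log hnpos]
      _ = (n : ℝ) ^ (0.75 : ℝ) := by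
          rw [← Real.exp_add, Real.rpow_def_of_pos hnpos]
          ring_nf
  have h2 : (n : ℝ) ^ (0.75 : ℝ) * (n : ℝ) ^ (0.15 : ℝ) = (n : ℝ) ^ (0.9 : ℝ) := by
    rw [← Real.rpow_add hnpos]
    norm_num
  have h3 := mul_le_mul_of_nonneg_left h1 (Real.exp_pos 1).le
  nlinarith

theorem tendsto_grProb_all_degree_gt (hp0 : ∀ n, 0 ≤ p n) (hp1 : ∀ n, p n ≤ 1)
    (hhigh : ∀ᶠ n : ℕ in atTop, n * p n ≤ 1.1 * Real.log n) :
    Tendsto (fun n : ℕ => grProb n (p n) fun G => ∀ u, ⌊0.08 * Real.log n⌋₊ < G.degree u)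
      atTop (nhds 0) := by
  have hp := tendsto_zero_of_le_log hp0 hhigh
  have hlim : Tendsto (fun n : ℕ => 4 * (Real.exp (0 - 0.0045 * Real.log n) + p n) +
      2 * Real.exp (1 / 6 - 0.0022 * Real.log n)) atTop (nhds 0) := by
    have := (((tendsto_exp_sub_mul_log (c := 0) (by norm_num : (0 : ℝ) < 0.0045)).add
      hp).const_mul 4).add ((tendsto_exp_sub_mul_log (c := 1 / 6)
        (by norm_num : (0 : ℝ) < 0.0022)).const_mul 2)
    simpa using this
  refine squeeze_zero' (Eventually.of_forall fun n => grProb_nonneg (hp0 n) (hp1 n) _) ?_ hlim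
  filter_upwards [hhigh, eventually_ge_atTop 2,
    hp.eventually (eventually_le_nhds (by norm_num : (0 : ℝ) < 0.001))] with n hn hn2 hps
  have hnpos : (0 : ℝ) < n := by exact_mod_cast (by omega : 0 < n)
  have h0 := hp0 n
  have hlog : 0 ≤ Real.log n := Real.log_natCast_nonneg n
  have hsub : ((n - 1 : ℕ) : ℝ) * p n ≤ 1.1 * Real.log n := by
    refine le_trans ?_ hn
    gcongr
    omega
  have hpow : ∀ {z s : ℝ}, 0 ≤ z → 0 ≤ s → z ≤ 1 + s * p n →
      z ^ (n - 1) ≤ Real.exp (s * (1.1 * Real.log n)) := by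
    intro z s hz hs hle
    calc z ^ (n - 1) ≤ (1 + s * p n) ^ (n - 1) := by gcongr
      _ ≤ Real.exp ((n - 1 : ℕ) * (s * p n)) := one_add_pow_le_exp (by positivity) _
      _ ≤ _ := by
          refine Real.exp_le_exp.2 ?_
          nlinarith
  refine (grProb_all_degree_gt_le (x := 0.05) (y := 0.06) h0 (by linarith) (by norm_num)
    (by norm_num) hn2 _).trans ?_
  have hm : 0 < 1 - p n + p n * 0.05 := by linarith
  have hratio : (1 - p n + p n * 0.05 ^ 2) / (1 - p n + p n * 0.05) ^ 2 ≤ 1 + 0.905 * p n := by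
    rw [div_le_iff₀ (by positivity)]
    nlinarith [mul_nonneg h0 (by linarith : 0 ≤ 0.001 - p n), mul_nonneg h0 (mul_nonneg h0 h0)]
  have hratio' : (1 - p n + p n * 0.06) / (1 - p n + p n * 0.05) ≤ 1 + 0.0101 * p n := by
    rw [div_le_iff₀ hm]
    nlinarith [mul_nonneg h0 (by linarith : 0 ≤ 0.001 - p n)]
  have hT1 : ((1 - p n + p n * 0.05 ^ 2) / (1 - p n + p n * 0.05) ^ 2) ^ (n - 1) / n ≤
      Real.exp (0 - 0.0045 * Real.log n) := by
    have hexp : Real.exp (0 - 0.0045 * Real.log n) * n =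
        Real.exp (0 - 0.0045 * Real.log n + Real.log n) := by
      rw [Real.exp_add, Real.exp_log hnpos]
    rw [div_le_iff₀ hnpos, hexp]
    exact (hpow (div_nonneg (by linarith) (by positivity)) (by norm_num) hratio).trans
      (Real.exp_le_exp.2 (by linarith))
  have hT3 : ((0.05 : ℝ) / 0.06) ^ ⌊0.08 * Real.log n⌋₊ *
      ((1 - p n + p n * 0.06) / (1 - p n + p n * 0.05)) ^ (n - 1) ≤
      Real.exp (1 / 6 - 0.0022 * Real.log n) := by
    have hbase : (0.05 : ℝ) / 0.06 ≤ Real.exp (-(1 / 6)) := by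
      have := Real.add_one_le_exp (-(1 / 6) : ℝ)
      norm_num at this ⊢
      linarith
    have hfloor := Nat.lt_floor_add_one (0.08 * Real.log n)
    calc _ ≤ Real.exp (-(1 / 6)) ^ ⌊0.08 * Real.log n⌋₊ *
          Real.exp (0.0101 * (1.1 * Real.log n)) := by
          have hnn := div_nonneg (by linarith : 0 ≤ 1 - p n + p n * 0.06) hm.le
          gcongr
          exact hpow hnn (by norm_num) hratio'
      _ ≤ _ := by
          rw [← Real.exp_nat_mul, ← Real.exp_add]
          refine Real.exp_le_exp.2 ?_
          linarith
  linarith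

theorem exp_neg_seven_quarters_le : Real.exp (-1.75) ≤ 0.174 := by
  have h7 : (Real.exp (-1.75))⁻¹ ^ 4 = Real.exp 1 ^ 7 := by
    rw [← Real.exp_neg, ← Real.exp_nat_mul, ← Real.exp_nat_mul]
    norm_num
  have he : (2.718 : ℝ) ^ 7 ≤ Real.exp 1 ^ 7 := by
    have := Real.exp_one_gt_d9
    gcongr
    linarith
  by_contra! hlt
  have : (Real.exp (-1.75))⁻¹ ^ 4 ≤ (0.174 : ℝ)⁻¹ ^ 4 := by gcongr
  norm_num at *
  linarith

theorem eventually_low_weight_le (hp0 : ∀ n, 0 ≤ p n)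
    (hlow : ∀ᶠ n : ℕ in atTop, Real.log n ≤ n * p n)
    (hhigh : ∀ᶠ n : ℕ in atTop, n * p n ≤ 1.1 * Real.log n) :
    ∀ᶠ n : ℕ in atTop, n * ((Real.exp (-1.75) ^ ⌊0.17 * Real.log n⌋₊)⁻¹ *
      (1 - p n + p n * Real.exp (-1.75)) ^ (n - 2)) ^ 2 ≤
      Real.exp (2 - 0.057 * Real.log n) := by
  filter_upwards [hlow, eventually_ge_atTop 2, (tendsto_zero_of_le_log hp0 hhigh).eventually
    (eventually_le_nhds (by norm_num : (0 : ℝ) < 0.5))] with n hn hn2 hps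
  have hnpos : (0 : ℝ) < n := by exact_mod_cast (by omega : 0 < n)
  have h0 := hp0 n
  have hx := exp_neg_seven_quarters_le
  have hx0 := Real.exp_pos (-1.75)
  have hfloor := Nat.floor_le (a := 0.17 * Real.log n)
    (mul_nonneg (by norm_num) (Real.log_natCast_nonneg n))
  have h1 : (Real.exp (-1.75) ^ ⌊0.17 * Real.log n⌋₊)⁻¹ ≤ Real.exp (0.2975 * Real.log n) := by
    rw [← Real.exp_nat_mul, ← Real.exp_neg]
    refine Real.exp_le_exp.2 ?_
    linarith
  have h2 : (1 - p n + p n * Real.exp (-1.75)) ^ (n - 2) ≤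
      Real.exp (1 - 0.826 * Real.log n) := by
    calc _ ≤ Real.exp (-(0.826 * p n)) ^ (n - 2) := by
          have hnn : 0 ≤ 1 - p n + p n * Real.exp (-1.75) := by nlinarith
          gcongr
          have := Real.add_one_le_exp (-(0.826 * p n))
          nlinarith
      _ ≤ _ := by
          rw [← Real.exp_nat_mul, Nat.cast_sub hn2]
          refine Real.exp_le_exp.2 ?_
          push_cast
          linarith
  have h3 : 0 ≤ (1 - p n + p n * Real.exp (-1.75)) ^ (n - 2) :=
    pow_nonneg (by nlinarith) _
  calc _ ≤ n * (Real.exp (0.2975 * Real.log n) * Real.exp (1 - 0.826 * Real.log n)) ^ 2 := by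
        gcongr
    _ = Real.exp (Real.log n) *
        (Real.exp (0.2975 * Real.log n) * Real.exp (1 - 0.826 * Real.log n)) ^ 2 := by
        rw [Real.exp_log hnpos]
    _ = _ := by
        rw [← Real.exp_add, ← Real.exp_nat_mul, ← Real.exp_add]
        congr 1
        push_cast
        ring

theorem tendsto_pow_mul_exp_neg_log (k : ℕ) {c s : ℝ} (hs : 0 < s) :
    Tendsto (fun n : ℕ => Real.log n ^ k * Real.exp (c - s * Real.log n)) atTop (nhds 0) := by
  have h := ((Real.tendsto_pow_mul_exp_neg_atTop_nhds_zero k).comp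
    (tendsto_log_natCast.const_mul_atTop hs)).const_mul (Real.exp c * (s ^ k)⁻¹)
  rw [mul_zero] at h
  refine h.congr fun n => ?_
  simp only [Function.comp_apply]
  rw [sub_eq_add_neg, Real.exp_add, mul_pow]
  field_simp

theorem tendsto_grProb_low_adj (hp0 : ∀ n, 0 ≤ p n) (hp1 : ∀ n, p n ≤ 1)
    (hlow : ∀ᶠ n : ℕ in atTop, Real.log n ≤ n * p n)
    (hhigh : ∀ᶠ n : ℕ in atTop, n * p n ≤ 1.1 * Real.log n) :
    Tendsto (fun n : ℕ => grProb n (p n) fun G => ∃ u v,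
      G.degree u ≤ ⌊0.17 * Real.log n⌋₊ ∧ G.degree v ≤ ⌊0.17 * Real.log n⌋₊ ∧ G.Adj u v)
      atTop (nhds 0) := by
  have hlim := (tendsto_pow_mul_exp_neg_log 1 (c := 2)
    (by norm_num : (0 : ℝ) < 0.057)).const_mul 2.2
  rw [mul_zero] at hlim
  refine squeeze_zero' (Eventually.of_forall fun n => grProb_nonneg (hp0 n) (hp1 n) _) ?_ hlim
  filter_upwards [hhigh, eventually_low_weight_le hp0 hlow hhigh,
    (tendsto_zero_of_le_log hp0 hhigh).eventually
    (eventually_le_nhds (by norm_num : (0 : ℝ) < 1 / 2))] with n hn hw hps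
  refine (grProb_low_adj_le (hp0 n) hps (Real.exp_pos (-1.75))
    (Real.exp_le_one_iff.2 (by norm_num)) _).trans ?_
  calc _ = 2 * (n * p n) * (n * ((Real.exp (-1.75) ^ ⌊0.17 * Real.log n⌋₊)⁻¹ *
        (1 - p n + p n * Real.exp (-1.75)) ^ (n - 2)) ^ 2) := by ring
    _ ≤ 2 * (1.1 * Real.log n) * Real.exp (2 - 0.057 * Real.log n) := by
        have := Real.log_natCast_nonneg n
        gcongr
    _ = _ := by ring

theorem tendsto_grProb_low_common (hp0 : ∀ n, 0 ≤ p n) (hp1 : ∀ n, p n ≤ 1)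
    (hlow : ∀ᶠ n : ℕ in atTop, Real.log n ≤ n * p n)
    (hhigh : ∀ᶠ n : ℕ in atTop, n * p n ≤ 1.1 * Real.log n) :
    Tendsto (fun n : ℕ => grProb n (p n) fun G => ∃ w u v,
      G.degree u ≤ ⌊0.17 * Real.log n⌋₊ ∧ G.degree v ≤ ⌊0.17 * Real.log n⌋₊ ∧ u ≠ v ∧
      G.Adj w u ∧ G.Adj w v) atTop (nhds 0) := by
  have hlim := (tendsto_pow_mul_exp_neg_log 2 (c := 2)
    (by norm_num : (0 : ℝ) < 0.057)).const_mul 4.84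
  rw [mul_zero] at hlim
  refine squeeze_zero' (Eventually.of_forall fun n => grProb_nonneg (hp0 n) (hp1 n) _) ?_ hlim
  filter_upwards [hhigh, eventually_low_weight_le hp0 hlow hhigh,
    (tendsto_zero_of_le_log hp0 hhigh).eventually
    (eventually_le_nhds (by norm_num : (0 : ℝ) < 1 / 2))] with n hn hw hps
  refine (grProb_low_common_le (hp0 n) hps (Real.exp_pos (-1.75))
    (Real.exp_le_one_iff.2 (by norm_num)) _).trans ?_
  calc _ = 4 * (n * p n) ^ 2 * (n * ((Real.exp (-1.75) ^ ⌊0.17 * Real.log n⌋₊)⁻¹ *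
        (1 - p n + p n * Real.exp (-1.75)) ^ (n - 2)) ^ 2) := by ring
    _ ≤ 4 * (1.1 * Real.log n) ^ 2 * Real.exp (2 - 0.057 * Real.log n) := by
        have := Real.log_natCast_nonneg n
        have := mul_nonneg (Nat.cast_nonneg (α := ℝ) n) (hp0 n)
        gcongr
    _ = _ := by ring

end Asymptotics

theorem sum_card_adj_le_of_edges_le {V : Type*} [Fintype V] (G : SimpleGraph V) (S : Finset V)
    {k : ℕ} (h : (G.edgeFinset.filter fun e => ∀ v ∈ e, v ∈ S).card ≤ k) :
    ∑ u ∈ S, (S.filter fun w => G.Adj u w).card ≤ 2 * k := by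
  refine le_trans ?_ ((sum_card_adj_eq_two_mul G fun e => ∀ v ∈ e, v ∈ S).le.trans
    (Nat.mul_le_mul_left 2 (by convert h)))
  refine (Finset.sum_le_sum fun u hu => Finset.card_le_card fun w hw => ?_).trans
    (Finset.sum_le_sum_of_subset (Finset.subset_univ S))
  rw [Finset.mem_filter] at hw
  simp [hu, hw.1, hw.2]

theorem aas_stp_eq_minDegree (p : ℕ → ℝ) (hp0 : ∀ n, 0 ≤ p n) (hp1 : ∀ n, p n ≤ 1)
    (hlow : Filter.Tendsto (fun n : ℕ => (n : ℝ) * p n - Real.log n) Filter.atTop Filter.atTop)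
    (hhigh : ∀ᶠ n : ℕ in Filter.atTop, p n ≤ 1.1 * Real.log n / n) :
    Filter.Tendsto
      (fun n : ℕ => grProb n (p n) fun G => stp G = G.minDegree)
      Filter.atTop (nhds 1) := by
  have hlow' : ∀ᶠ n : ℕ in atTop, Real.log n ≤ n * p n := by
    filter_upwards [hlow.eventually_ge_atTop 0] with n hn
    linarith
  have hhigh' : ∀ᶠ n : ℕ in atTop, n * p n ≤ 1.1 * Real.log n := by
    filter_upwards [hhigh, eventually_gt_atTop 0] with n hn hn0
    have : (0 : ℝ) < n := by exact_mod_cast hn0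
    rw [le_div_iff₀ this] at hn
    linarith
  have hbad : Tendsto (fun n : ℕ => grProb n (p n) fun G => ¬ stp G = G.minDegree)
      atTop (nhds 0) := by
    have hsum := (tendsto_grProb_all_degree_gt hp0 hp1 hhigh').add
      ((tendsto_grProb_low_adj hp0 hp1 hlow' hhigh').add
      ((tendsto_grProb_low_common hp0 hp1 hlow' hhigh').add
      ((tendsto_grProb_dense hp0 hp1 hhigh').add (tendsto_grProb_small_cut hp0 hp1 hlow'))))
    simp only [add_zero] at hsum
    refine squeeze_zero' (Eventually.of_forall fun n => grProb_nonneg (hp0 n) (hp1 n) _) ?_ hsum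
    have hlogM : ∀ᶠ n : ℕ in atTop, Real.log n ≤ (n : ℝ) ^ (0.9 : ℝ) := by
      filter_upwards [tendsto_natCast_atTop_atTop.eventually
        ((isLittleO_log_rpow_atTop (by norm_num : (0 : ℝ) < 0.9)).bound one_pos)] with n hn
      rw [one_mul, Real.norm_of_nonneg (Real.log_natCast_nonneg n),
        Real.norm_of_nonneg (by positivity)] at hn
      exact hn
    filter_upwards [eventually_ge_atTop 2, hlogM,
      tendsto_log_natCast.eventually_ge_atTop 5000] with n hn2 hM hlog
    have : Nontrivial (Fin n) := Fin.nontrivial_iff_two_le.2 hn2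
    have ha := Nat.floor_le (a := 0.08 * Real.log n) (by linarith)
    refine (grProb_or_le (hp0 n) (hp1 n) fun G hG => ?_).trans (add_le_add_right
      ((grProb_or_le (hp0 n) (hp1 n) fun G hG => hG).trans (add_le_add_right
      ((grProb_or_le (hp0 n) (hp1 n) fun G hG => hG).trans (add_le_add_right
      (grProb_or_le (hp0 n) (hp1 n) fun G hG => hG) _)) _)) _)
    by_contra! hcon
    obtain ⟨⟨u, hu⟩, hadj, hcommon, hdense, hcut⟩ := hcon
    have hdeg := (G.minDegree_le_degree u).trans hu
    have hdeg' : (G.minDegree : ℝ) ≤ 0.08 * Real.log n := le_trans (by exact_mod_cast hdeg) ha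
    refine hG (Expands.stp_eq_minDegree (K := ⌊0.17 * Real.log n⌋₊) (C := 21)
      (M := ⌊(n : ℝ) ^ (0.9 : ℝ)⌋₊) ⟨G.minDegree_le_degree, ?_, ?_, ?_, ?_, ?_, ?_⟩)
    · refine Nat.le_floor ?_
      push_cast
      linarith
    · exact fun u v hu hv => hadj u v hu hv
    · exact fun w u v hu hv huv hwu => hcommon w u v hu hv huv hwu
    · intro S hS
      rw [mul_assoc]
      exact sum_card_adj_le_of_edges_le G S (le_of_eq_of_le (by congr!) (hdense S hS))
    · intro S hS hSn
      exact hcut S hS (by simpa using hSn)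
    · refine Nat.le_floor ?_
      push_cast
      linarith
  have h := hbad.const_sub 1
  rw [sub_zero] at h
  refine h.congr fun n => ?_
  rw [← grProb_add_not n (p n) fun G => stp G = G.minDegree]
  ring
end
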